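/- Let κ_α(x,y) = |x−y|^{α−n} be the α-Riesz kernel on ℝⁿ, n ≥ 2, with α ∈ (0,2], α < n. Let A be a proper closed subset of ℝⁿ that is not inner α-thin at infinity (for instance A = {|x| ≥ 1}), and let ω ∈ E⁺(A^c) be nonzero. Then ω^A ≠ ω while ω^A(ℝⁿ) = ω(ℝⁿ); consequently, since both ω and ω^A belong to the convex class Γ_{A,ω} := { ν ∈ E⁺ : U^ν ≥ U^ω nearly everywhere on A }, every measure a·ω + b·ω^A with a, b ∈ [0,1], a + b = 1 has minimum total mass in Γ_{A,ω}, so there are infinitely many measures of minimum total mass in Γ_{A,ω}. -/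

import Mathlib

open MeasureTheory Filter Set Topology ENNReal CompactlySupported UniformConvergence

namespace Balayage
open scoped Classical

variable {X : Type*} [TopologicalSpace X] [MeasurableSpace X]

/-- A kernel: symmetric, lower semicontinuous, `[0,∞]`-valued. -/
structure IsKernel (κ : X → X → ℝ≥0∞) : Prop where
  symm : ∀ x y, κ x y = κ y x
  lsc : LowerSemicontinuous fun p : X × X => κ p.1 p.2

/-- The potential `U^μ(x) = ∫ κ(x,y) dμ(y)`. -/
noncomputable def potential (κ : X → X → ℝ≥0∞) (μ : Measure X) (x : X) : ℝ≥0∞ :=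
  ∫⁻ y, κ x y ∂μ

/-- The mutual energy `I(μ,ν) = ∫∫ κ(x,y) dν(y) dμ(x)` of two positive measures. -/
noncomputable def energy (κ : X → X → ℝ≥0∞) (μ ν : Measure X) : ℝ≥0∞ :=
  ∫⁻ x, potential κ ν x ∂μ

/-- A positive Radon measure (regular Borel measure, finite on compacts). -/
def IsRadon (μ : Measure X) : Prop := μ.Regular

/-- Finite energy: `I(μ) < ∞`. -/
def FiniteEnergy (κ : X → X → ℝ≥0∞) (μ : Measure X) : Prop := energy κ μ μ < ⊤

/-- Membership in the cone `E⁺` of positive Radon measures of finite energy. -/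
def memE (κ : X → X → ℝ≥0∞) (μ : Measure X) : Prop := IsRadon μ ∧ FiniteEnergy κ μ

/-- Membership in `E⁺(A)`: measures of `E⁺` concentrated on `A`
(i.e. the complement of `A` is negligible). -/
def memEOn (κ : X → X → ℝ≥0∞) (A : Set X) (μ : Measure X) : Prop :=
  memE κ μ ∧ μ Aᶜ = 0

/-- The strong (energy) distance `‖μ-ν‖ = √(I(μ)+I(ν)-2I(μ,ν))`. -/
noncomputable def sDist (κ : X → X → ℝ≥0∞) (μ ν : Measure X) : ℝ :=
  Real.sqrt ((energy κ μ μ).toReal + (energy κ ν ν).toReal - 2 * (energy κ μ ν).toReal)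

/-- Membership in `E'(A)`, the strong closure of `E⁺(A)` in `E⁺`. -/
def memEClos (κ : X → X → ℝ≥0∞) (A : Set X) (μ : Measure X) : Prop :=
  memE κ μ ∧ ∀ ε : ℝ, 0 < ε → ∃ ν, memEOn κ A ν ∧ sDist κ μ ν < ε

/-- The capacity of a compact set: the inverse of the minimal energy of
probability measures concentrated on it. -/
noncomputable def capC (κ : X → X → ℝ≥0∞) (K : Set X) : ℝ≥0∞ :=
  (⨅ (μ : Measure X) (_ : IsProbabilityMeasure μ) (_ : μ Kᶜ = 0), energy κ μ μ)⁻¹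

/-- The inner capacity `cp_* A`: supremum of capacities of compact subsets. -/
noncomputable def innerCap (κ : X → X → ℝ≥0∞) (A : Set X) : ℝ≥0∞ :=
  ⨆ (K : Set X) (_ : IsCompact K) (_ : K ⊆ A), capC κ K

/-- The outer capacity `cp^* A`: infimum of inner capacities of open supersets. -/
noncomputable def outerCap (κ : X → X → ℝ≥0∞) (A : Set X) : ℝ≥0∞ :=
  ⨅ (D : Set X) (_ : IsOpen D) (_ : A ⊆ D), innerCap κ D

/-- Strict positive definiteness (energy principle), stated for pairs of positive
measures of finite energy: `I(μ-ν) ≥ 0`, with equality only for `μ = ν`. -/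
def StrictlyPosDef (κ : X → X → ℝ≥0∞) : Prop :=
  ∀ μ ν : Measure X, IsRadon μ → IsRadon ν → FiniteEnergy κ μ → FiniteEnergy κ ν →
    (2 * energy κ μ ν ≤ energy κ μ μ + energy κ ν ν) ∧
    (2 * energy κ μ ν = energy κ μ μ + energy κ ν ν → μ = ν)

/-- Vague convergence of a sequence of measures: convergence of integrals of
continuous compactly supported functions. -/
def VagueTendsto (μ : ℕ → Measure X) (μ₀ : Measure X) : Prop :=
  ∀ f : X → ℝ, Continuous f → HasCompactSupport f →
    Tendsto (fun j => ∫ x, f x ∂(μ j)) atTop (nhds (∫ x, f x ∂μ₀))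

/-- A perfect kernel: strictly positive definite, `E⁺` strongly complete, and the strong
topology on `E⁺` finer than the vague topology (sequential formulation; sequences suffice
on second-countable spaces). -/
structure Perfect (κ : X → X → ℝ≥0∞) : Prop where
  posdef : StrictlyPosDef κ
  complete : ∀ μ : ℕ → Measure X, (∀ j, memE κ (μ j)) →
    (∀ ε : ℝ, 0 < ε → ∃ N, ∀ m ≥ N, ∀ n ≥ N, sDist κ (μ m) (μ n) < ε) →
    ∃ μ₀, memE κ μ₀ ∧ Tendsto (fun j => sDist κ (μ j) μ₀) atTop (nhds 0)
  finerThanVague : ∀ (μ : ℕ → Measure X) (μ₀ : Measure X), (∀ j, memE κ (μ j)) →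
    memE κ μ₀ → Tendsto (fun j => sDist κ (μ j) μ₀) atTop (nhds 0) → VagueTendsto μ μ₀

/-- The domination principle. -/
def Domination (κ : X → X → ℝ≥0∞) : Prop :=
  ∀ μ ν : Measure X, memE κ μ → IsRadon ν →
    (∀ᵐ x ∂μ, potential κ μ x ≤ potential κ ν x) → ∀ x, potential κ μ x ≤ potential κ ν x

/-- `h`-Ugaheri's maximum principle; for `h = 1` this is Frostman's maximum principle. -/
def Ugaheri (κ : X → X → ℝ≥0∞) (h : ℝ) : Prop :=
  ∀ μ : Measure X, memE κ μ → ∀ c : ℝ, 0 < c →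
    (∀ᵐ x ∂μ, potential κ μ x ≤ ENNReal.ofReal c) →
    ∀ x, potential κ μ x ≤ ENNReal.ofReal (h * c)

/-- Condition (R1): the kernel is perfect and satisfies the domination and
`h`-Ugaheri maximum principles for some `h ∈ [1, ∞)`. -/
structure R1 (κ : X → X → ℝ≥0∞) : Prop where
  perfect : Perfect κ
  domination : Domination κ
  ugaheri : ∃ h : ℝ, 1 ≤ h ∧ Ugaheri κ h

/-- Condition (R2): `κ(x,y)` is continuous and finite off the diagonal. -/
def R2 (κ : X → X → ℝ≥0∞) : Prop :=
  ContinuousOn (fun p : X × X => κ p.1 p.2) {p : X × X | p.1 ≠ p.2} ∧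
    ∀ x y : X, x ≠ y → κ x y ≠ ⊤

/-- Condition (R3): `κ(·,y) → 0` uniformly on compact sets as `y` tends to the
Alexandroff point of `X`. -/
def R3 (κ : X → X → ℝ≥0∞) : Prop :=
  ∀ K : Set X, IsCompact K → ∀ ε : ℝ≥0∞, 0 < ε →
    ∃ K' : Set X, IsCompact K' ∧ ∀ y ∉ K', ∀ x ∈ K, κ x y < ε

/-- `μA` is the inner balayage of `ω` onto `A`: it belongs to `E'(A)` and its potential
coincides with that of `ω` nearly everywhere on `A` (up to a set of inner capacity zero). -/
def IsInnerBalayage (κ : X → X → ℝ≥0∞) (A : Set X) (ω μA : Measure X) : Prop :=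
  memEClos κ A μA ∧ innerCap κ {x ∈ A | potential κ μA x ≠ potential κ ω x} = 0

/-- `μA` is the outer balayage of `ω` onto `A`: it belongs to `E'(A)` and its potential
coincides with that of `ω` quasi-everywhere on `A` (up to a set of outer capacity zero). -/
def IsOuterBalayage (κ : X → X → ℝ≥0∞) (A : Set X) (ω μA : Measure X) : Prop :=
  memEClos κ A μA ∧ outerCap κ {x ∈ A | potential κ μA x ≠ potential κ ω x} = 0

/-- Membership in the class `Γ_{A,ω}` of positive finite-energy Radon measures whose
potential dominates that of `ω` nearly everywhere on `A`. -/
def memGamma (κ : X → X → ℝ≥0∞) (A : Set X) (ω ν : Measure X) : Prop :=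
  memE κ ν ∧ innerCap κ {x ∈ A | ¬ potential κ ω x ≤ potential κ ν x} = 0

/-- Euclidean space `ℝⁿ`. -/
abbrev Rn (n : ℕ) := EuclideanSpace ℝ (Fin n)

/-- The α-Riesz kernel `|x-y|^{α-n}` on `ℝⁿ` (with value `∞` on the diagonal). -/
noncomputable def riesz (n : ℕ) (α : ℝ) (x y : Rn n) : ℝ≥0∞ :=
  if x = y then ⊤ else ENNReal.ofReal (‖x - y‖ ^ (α - (n : ℝ)))

/-- `Q ⊆ ℝⁿ` is inner α-thin at infinity:
`Σ_j cp_*(Q_j)/q^{j(n-α)} < ∞` where `Q_j = Q ∩ {q^j ≤ |x| < q^{j+1}}`. -/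
def InnerThinAtInfinity (n : ℕ) (α : ℝ) (Q : Set (Rn n)) : Prop :=
  ∃ q : ℝ, 1 < q ∧
    (∑' j : ℕ, innerCap (riesz n α) (Q ∩ {x : Rn n | q ^ j ≤ ‖x‖ ∧ ‖x‖ < q ^ (j + 1)}) /
      ENNReal.ofReal (q ^ ((j : ℝ) * ((n : ℝ) - α)))) < ⊤

section

variable {n : ℕ}

/-- The Gaussian kernel of variance `s` per coordinate; it vanishes for `s ≤ 0`. -/
noncomputable def heat (n : ℕ) (s : ℝ) (x : Rn n) : ℝ≥0∞ :=
  if 0 < s then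
    ENNReal.ofReal ((2 * Real.pi * s) ^ (-((n : ℝ) / 2)) * Real.exp (-(1 / (2 * s)) * ‖x‖ ^ 2))
  else 0


lemma measurable_heat_uncurry : Measurable fun p : ℝ × Rn n => heat n p.1 p.2 := by
  unfold heat
  refine Measurable.ite (measurableSet_lt measurable_const measurable_fst) ?_ measurable_const
  fun_prop

@[fun_prop]
lemma Measurable.heat {Y : Type*} [MeasurableSpace Y] {f : Y → ℝ} {g : Y → Rn n}
    (hf : Measurable f) (hg : Measurable g) : Measurable fun y => heat n (f y) (g y) :=
  measurable_heat_uncurry.comp (hf.prodMk hg)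

lemma continuous_heat (s : ℝ) : Continuous (heat n s) := by
  unfold heat
  split_ifs
  · exact ENNReal.continuous_ofReal.comp (by fun_prop)
  · exact continuous_const

lemma heat_neg (s : ℝ) (x : Rn n) : heat n s (-x) = heat n s x := by
  simp [heat]

lemma heat_sub_comm (s : ℝ) (x y : Rn n) : heat n s (x - y) = heat n s (y - x) := by
  rw [← heat_neg, neg_sub]

lemma heat_le (s : ℝ) (x : Rn n) :
    heat n s x ≤ ENNReal.ofReal ((2 * Real.pi * s) ^ (-((n : ℝ) / 2))) := by
  unfold heat
  split_ifs with h
  · refine ENNReal.ofReal_le_ofReal (mul_le_of_le_one_right (by positivity) ?_)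
    rw [Real.exp_le_one_iff]
    have : 0 ≤ 1 / (2 * s) * ‖x‖ ^ 2 := by positivity
    linarith
  · exact zero_le

lemma lintegral_gaussian {b : ℝ} (hb : 0 < b) :
    ∫⁻ x : Rn n, ENNReal.ofReal (Real.exp (-b * ‖x‖ ^ 2))
      = ENNReal.ofReal ((Real.pi / b) ^ ((n : ℝ) / 2)) := by
  have h := GaussianFourier.integral_rexp_neg_mul_sq_norm (V := Rn n) hb
  rw [finrank_euclideanSpace, Fintype.card_fin] at h
  rw [← h, ← ofReal_integral_eq_lintegral_ofReal]
  · by_contra hni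
    rw [integral_undef hni] at h
    have : 0 < (Real.pi / b) ^ ((n : ℝ) / 2) := by positivity
    linarith
  · exact ae_of_all _ fun x => (Real.exp_pos _).le

lemma lintegral_heat {s : ℝ} (hs : 0 < s) : ∫⁻ x : Rn n, heat n s x = 1 := by
  simp only [heat, hs, if_true]
  simp_rw [ENNReal.ofReal_mul (show 0 ≤ (2 * Real.pi * s) ^ (-((n : ℝ) / 2)) by positivity)]
  rw [lintegral_const_mul _ (by fun_prop), lintegral_gaussian (by positivity),
    ← ENNReal.ofReal_mul (by positivity), ← ENNReal.ofReal_one]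
  congr 1
  rw [show Real.pi / (1 / (2 * s)) = 2 * Real.pi * s by field_simp,
    ← Real.rpow_add (by positivity)]
  simp

lemma lintegral_heat_sub {s : ℝ} (hs : 0 < s) (x : Rn n) : ∫⁻ y : Rn n, heat n s (x - y) = 1 := by
  rw [lintegral_sub_left_eq_self (fun y => heat n s y) x, lintegral_heat hs]

lemma lintegral_heat_sub_le (s : ℝ) (x : Rn n) : ∫⁻ y : Rn n, heat n s (x - y) ≤ 1 := by
  by_cases hs : 0 < s
  · exact (lintegral_heat_sub hs x).le
  · simp [heat, hs]

/-- Semigroup property of the Gaussian kernels. -/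
lemma lintegral_heat_mul_heat {s t : ℝ} (hs : 0 < s) (ht : 0 < t) (x z : Rn n) :
    ∫⁻ y : Rn n, heat n s (x - y) * heat n t (y - z) = heat n (s + t) (x - z) := by
  have hst : 0 < s + t := add_pos hs ht
  set m : Rn n := (t / (s + t)) • x + (s / (s + t)) • z with hm
  set b : ℝ := (s + t) / (2 * s * t) with hb
  have hb0 : 0 < b := by positivity
  set c : ℝ := (2 * Real.pi * s) ^ (-((n : ℝ) / 2)) * (2 * Real.pi * t) ^ (-((n : ℝ) / 2)) *
    Real.exp (-(1 / (2 * (s + t))) * ‖x - z‖ ^ 2) with hc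
  have hc0 : 0 ≤ c := by positivity
  have key : ∀ y : Rn n, heat n s (x - y) * heat n t (y - z)
      = ENNReal.ofReal c * ENNReal.ofReal (Real.exp (-b * ‖y - m‖ ^ 2)) := by
    intro y
    simp only [heat, hs, ht, if_true]
    rw [← ENNReal.ofReal_mul (by positivity), ← ENNReal.ofReal_mul hc0]
    congr 1
    have hsq : -(1 / (2 * s)) * ‖x - y‖ ^ 2 + -(1 / (2 * t)) * ‖y - z‖ ^ 2
        = -(1 / (2 * (s + t))) * ‖x - z‖ ^ 2 + -b * ‖y - m‖ ^ 2 := by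
      have e1 : x - y = (s / (s + t)) • (x - z) - (y - m) := by
        rw [hm]
        have : x = (t / (s + t)) • x + (s / (s + t)) • x := by
          rw [← add_smul, ← add_div, add_comm t s, div_self hst.ne', one_smul]
        nth_rewrite 1 [this]
        rw [smul_sub]; abel
      have e2 : y - z = (t / (s + t)) • (x - z) + (y - m) := by
        rw [hm]
        have : z = (t / (s + t)) • z + (s / (s + t)) • z := by
          rw [← add_smul, ← add_div, add_comm t s, div_self hst.ne', one_smul]
        nth_rewrite 1 [this]
        rw [smul_sub]; abel
      rw [e1, e2, norm_sub_sq_real, norm_add_sq_real, norm_smul, norm_smul,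
        real_inner_smul_left, real_inner_smul_left, mul_pow, mul_pow, Real.norm_eq_abs,
        Real.norm_eq_abs, sq_abs, sq_abs, hb]
      field_simp
      ring
    rw [hc]
    calc _ = (2 * Real.pi * s) ^ (-((n : ℝ) / 2)) * (2 * Real.pi * t) ^ (-((n : ℝ) / 2)) *
          Real.exp (-(1 / (2 * s)) * ‖x - y‖ ^ 2 + -(1 / (2 * t)) * ‖y - z‖ ^ 2) := by
            rw [Real.exp_add]; ring
      _ = _ := by rw [hsq, Real.exp_add]; ring
  simp_rw [key]
  rw [lintegral_const_mul _ (by fun_prop),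
    lintegral_sub_right_eq_self (fun y : Rn n => ENNReal.ofReal (Real.exp (-b * ‖y‖ ^ 2))) m,
    lintegral_gaussian hb0, ← ENNReal.ofReal_mul hc0]
  simp only [heat, hst, if_true]
  congr 1
  rw [hc]
  have : (2 * Real.pi * s) ^ (-((n : ℝ) / 2)) * (2 * Real.pi * t) ^ (-((n : ℝ) / 2)) *
      (Real.pi / b) ^ ((n : ℝ) / 2) = (2 * Real.pi * (s + t)) ^ (-((n : ℝ) / 2)) := by
    rw [← Real.mul_rpow (by positivity) (by positivity), Real.rpow_neg (by positivity),
      Real.rpow_neg (by positivity), ← Real.inv_rpow (by positivity),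
      ← Real.inv_rpow (by positivity),
      ← Real.mul_rpow (by positivity) (by positivity)]
    congr 1
    rw [hb]; field_simp
  rw [← this]; ring

/-- Gaussian smoothing of a measure. -/
noncomputable def smooth (μ : Measure (Rn n)) (s : ℝ) (x : Rn n) : ℝ≥0∞ :=
  ∫⁻ y, heat n s (x - y) ∂μ

/-- Gaussian smoothing of a function. -/
noncomputable def smoothF (v : Rn n → ℝ≥0∞) (s : ℝ) (x : Rn n) : ℝ≥0∞ :=
  ∫⁻ y, heat n s (x - y) * v y

lemma measurable_smooth_uncurry (μ : Measure (Rn n)) [SFinite μ] :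
    Measurable fun p : ℝ × Rn n => smooth μ p.1 p.2 := by
  unfold smooth
  exact Measurable.lintegral_prod_right'
    (f := fun q : (ℝ × Rn n) × Rn n => heat n q.1.1 (q.1.2 - q.2))   (by fun_prop)

@[fun_prop]
lemma Measurable.smooth {Y : Type*} [MeasurableSpace Y] {μ : Measure (Rn n)} [SFinite μ]
    {f : Y → ℝ} {g : Y → Rn n}
    (hf : Measurable f) (hg : Measurable g) : Measurable fun y => smooth μ (f y) (g y) :=
  (measurable_smooth_uncurry μ).comp (hf.prodMk hg)

lemma measurable_smoothF_uncurry {v : Rn n → ℝ≥0∞} (hv : Measurable v) :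
    Measurable fun p : ℝ × Rn n => smoothF v p.1 p.2 := by
  unfold smoothF
  exact Measurable.lintegral_prod_right'
    (f := fun q : (ℝ × Rn n) × Rn n => heat n q.1.1 (q.1.2 - q.2) * v q.2) (by fun_prop)

@[fun_prop]
lemma Measurable.smoothF {Y : Type*} [MeasurableSpace Y] {v : Rn n → ℝ≥0∞}
    {f : Y → ℝ} {g : Y → Rn n} (hv : Measurable v)
    (hf : Measurable f) (hg : Measurable g) : Measurable fun y => smoothF v (f y) (g y) :=
  (measurable_smoothF_uncurry hv).comp (hf.prodMk hg)

lemma smooth_restrict (D : Set (Rn n)) (hD : MeasurableSet D) (s : ℝ) (x : Rn n) :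
    smooth (volume.restrict D) s x = smoothF (D.indicator 1) s x := by
  unfold smooth smoothF
  rw [← lintegral_indicator hD]
  congr 1 with y
  by_cases hy : y ∈ D <;> simp [hy]

lemma smoothF_le_of_le {v : Rn n → ℝ≥0∞} {b : ℝ≥0∞} (h : ∀ x, v x ≤ b) (s : ℝ) (x : Rn n) :
    smoothF v s x ≤ b := by
  calc smoothF v s x ≤ ∫⁻ y, heat n s (x - y) * b := lintegral_mono fun y => by gcongr; exact h y
    _ = (∫⁻ y, heat n s (x - y)) * b := lintegral_mul_const _ (by fun_prop)
    _ ≤ 1 * b := by gcongr; exact lintegral_heat_sub_le s x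
    _ = b := one_mul b

lemma smoothF_mono {v w : Rn n → ℝ≥0∞} (h : ∀ x, v x ≤ w x) (s : ℝ) (x : Rn n) :
    smoothF v s x ≤ smoothF w s x :=
  lintegral_mono fun y => by gcongr; exact h y

lemma smoothF_add {v w : Rn n → ℝ≥0∞} (hv : Measurable v) (s : ℝ) (x : Rn n) :
    smoothF (fun y => v y + w y) s x = smoothF v s x + smoothF w s x := by
  unfold smoothF
  simp_rw [mul_add]
  exact lintegral_add_left (by fun_prop) _

lemma smoothF_const_mul {v : Rn n → ℝ≥0∞} (hv : Measurable v) (c : ℝ≥0∞) (s : ℝ) (x : Rn n) :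
    smoothF (fun y => c * v y) s x = c * smoothF v s x := by
  unfold smoothF
  simp_rw [mul_left_comm _ c]
  exact lintegral_const_mul _ (by fun_prop)

/-- Smoothing is symmetric. -/
lemma lintegral_mul_smoothF {v w : Rn n → ℝ≥0∞} (hv : Measurable v) (hw : Measurable w) (s : ℝ) :
    ∫⁻ x, v x * smoothF w s x = ∫⁻ x, smoothF v s x * w x := by
  unfold smoothF
  simp_rw [fun x => (lintegral_const_mul (μ := volume) (v x)
      (show Measurable fun y => heat n s (x - y) * w y by fun_prop)).symm,
    fun x => (lintegral_mul_const (μ := volume) (w x)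
      (show Measurable fun y => heat n s (x - y) * v y by fun_prop)).symm]
  rw [lintegral_lintegral_swap (by fun_prop)]
  congr 1 with x; congr 1 with y
  rw [heat_sub_comm]; ring

lemma lintegral_smooth_comm (μ ν : Measure (Rn n)) [SFinite μ] [SFinite ν] (s : ℝ) :
    ∫⁻ x, smooth ν s x ∂μ = ∫⁻ x, smooth μ s x ∂ν := by
  unfold smooth
  rw [lintegral_lintegral_swap (by fun_prop)]
  congr 1 with x; congr 1 with y
  rw [heat_sub_comm]

/-- Smoothing twice adds the variances. -/
lemma smoothF_smooth (μ : Measure (Rn n)) [SFinite μ] {r s : ℝ} (hr : 0 < r) (hs : 0 < s)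
    (x : Rn n) : smoothF (smooth μ s) r x = smooth μ (r + s) x := by
  unfold smoothF smooth
  simp_rw [fun y => (lintegral_const_mul (μ := μ) (heat n r (x - y))
      (show Measurable fun z => heat n s (y - z) by fun_prop)).symm]
  rw [lintegral_lintegral_swap (by fun_prop)]
  congr 1 with z
  exact lintegral_heat_mul_heat hr hs x z

lemma lintegral_smooth_mul_smooth (μ ν : Measure (Rn n)) [SFinite μ] [SFinite ν] {r s : ℝ}
    (hr : 0 < r) (hs : 0 < s) :
    ∫⁻ z, smooth μ r z * smooth ν s z = ∫⁻ x, smooth ν (r + s) x ∂μ := by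
  have h : ∀ x, smooth ν (r + s) x = ∫⁻ y, heat n r (x - y) * smooth ν s y := fun x =>
    (smoothF_smooth ν hr hs x).symm
  simp_rw [h]
  rw [lintegral_lintegral_swap (by fun_prop)]
  congr 1 with z
  rw [lintegral_mul_const _ (by fun_prop)]
  unfold smooth
  simp_rw [heat_sub_comm r z]

lemma two_mul_le_mul_self_add (a b : ℝ≥0∞) : 2 * (a * b) ≤ a * a + b * b := by
  induction a with
  | top => simp
  | coe a =>
    induction b with
    | top => simp
    | coe b =>
      norm_cast
      rw [← NNReal.coe_le_coe]; push_cast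
      nlinarith [sq_nonneg ((a : ℝ) - b)]

/-- The Gaussian energies decrease in the variance. -/
lemma lintegral_smooth_add_le (μ : Measure (Rn n)) [SFinite μ] {r s : ℝ}
    (hr : 0 < r) (hs : 0 < s) :
    ∫⁻ x, smooth μ (r + s) x ∂μ ≤ ∫⁻ x, smooth μ s x ∂μ := by
  have hs2 : 0 < s / 2 := by positivity
  set v := smooth μ (s / 2) with hv
  have hvm : Measurable v := by rw [hv]; fun_prop
  have e1 : ∫⁻ x, smooth μ (r + s) x ∂μ = ∫⁻ z, v z * smoothF v r z := by
    rw [show r + s = s / 2 + (r + s / 2) by ring,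
      ← lintegral_smooth_mul_smooth μ μ hs2 (by positivity)]
    congr 1 with z
    rw [hv, smoothF_smooth μ hr hs2]
  have e2 : ∫⁻ x, smooth μ s x ∂μ = ∫⁻ z, v z * v z := by
    rw [hv, lintegral_smooth_mul_smooth μ μ hs2 hs2, add_halves]
  rw [e1, e2]
  have h2 : 2 * ∫⁻ z, v z * smoothF v r z ≤ 2 * ∫⁻ z, v z * v z := by
    calc 2 * ∫⁻ z, v z * smoothF v r z
        = ∫⁻ z, ∫⁻ y, heat n r (z - y) * (2 * (v z * v y)) := by
          rw [← lintegral_const_mul _ (by fun_prop)]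
          congr 1 with z
          unfold smoothF
          rw [← lintegral_const_mul _ (by fun_prop), ← lintegral_const_mul _ (by fun_prop)]
          congr 1 with y
          ring
      _ ≤ ∫⁻ z, ∫⁻ y, (heat n r (z - y) * (v z * v z) + heat n r (z - y) * (v y * v y)) := by
          refine lintegral_mono fun z => lintegral_mono fun y => ?_
          rw [← mul_add]
          gcongr
          exact two_mul_le_mul_self_add _ _
      _ = (∫⁻ z, v z * v z) + ∫⁻ z, smoothF (fun y => v y * v y) r z * 1 := by
          rw [← lintegral_add_left (by fun_prop)]
          congr 1 with z
          rw [lintegral_add_left (by fun_prop), lintegral_mul_const _ (by fun_prop),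
            lintegral_heat_sub hr, one_mul, mul_one]
          rfl
      _ ≤ (∫⁻ z, v z * v z) + ∫⁻ z, v z * v z := by
          refine add_le_add le_rfl ?_
          rw [← lintegral_mul_smoothF (by fun_prop) measurable_const]
          refine lintegral_mono fun z => ?_
          exact mul_le_of_le_one_right (zero_le) (smoothF_le_of_le (fun _ => le_rfl) r z)
      _ = 2 * ∫⁻ z, v z * v z := (two_mul _).symm
  exact (ENNReal.mul_le_mul_iff_right (by simp) (by simp)).1 h2

/-- The potential density `s ^ (β - 1)` on the positive half-line. -/
noncomputable def stab (β s : ℝ) : ℝ≥0∞ := if 0 < s then ENNReal.ofReal (s ^ (β - 1)) else 0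

@[fun_prop]
lemma measurable_stab (β : ℝ) : Measurable (stab β) :=
  Measurable.ite measurableSet_Ioi (by fun_prop) measurable_const

lemma stab_of_pos {β s : ℝ} (hs : 0 < s) : stab β s = ENNReal.ofReal (s ^ (β - 1)) := if_pos hs

lemma stab_of_nonpos {β s : ℝ} (hs : s ≤ 0) : stab β s = 0 := if_neg hs.not_gt

lemma lintegral_stab_Iic_lt_top {β : ℝ} (hβ : 0 < β) {ε : ℝ} (hε : 0 < ε) :
    ∫⁻ s in Iic ε, stab β s < ⊤ := by
  have h : IntegrableOn (fun s : ℝ => s ^ (β - 1)) (Ioo 0 ε) :=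
    (intervalIntegral.integrableOn_Ioo_rpow_iff hε).2 (by linarith)
  calc ∫⁻ s in Iic ε, stab β s = ∫⁻ s in Iio ε, stab β s :=
        setLIntegral_congr Iio_ae_eq_Iic.symm
    _ ≤ ∫⁻ s in Ioo 0 ε, ENNReal.ofReal (s ^ (β - 1)) := by
        rw [← lintegral_indicator measurableSet_Iio, ← lintegral_indicator measurableSet_Ioo]
        refine lintegral_mono fun s => ?_
        by_cases hs : 0 < s
        · by_cases hs' : s < ε <;> simp [stab_of_pos, hs, hs']
        · by_cases hs' : s < ε <;> simp [stab_of_nonpos (not_lt.1 hs), hs']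
    _ < ⊤ := h.lintegral_lt_top

lemma lintegral_stab_Iic_pos (β : ℝ) {ε : ℝ} (hε : 0 < ε) : 0 < ∫⁻ s in Iic ε, stab β s := by
  rw [setLIntegral_pos_iff (by fun_prop)]
  refine lt_of_lt_of_le ?_ (measure_mono (show Ioo 0 ε ⊆ _ from fun s hs => ⟨?_, hs.2.le⟩))
  · simp [hε]
  · rw [Function.mem_support, stab_of_pos hs.1]
    simpa using Real.rpow_pos_of_pos hs.1 _

lemma lintegral_betaMeasure_stab {β : ℝ} (hβ0 : 0 < β) (hβ1 : β < 1) {ε s : ℝ} (hε : 0 < ε)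
    (hs : ε < s) :
    ∫⁻ w, ProbabilityTheory.betaPDF (1 - β) β w * stab β (s - ε / (1 - w)) = stab β s := by
  have hs0 : 0 < s := hε.trans hs
  set c : ℝ := 1 - ε / s with hc
  have hc0 : 0 < c := by rw [hc, sub_pos, div_lt_one hs0]; exact hs
  have hc1 : c < 1 := by rw [hc]; linarith [div_pos hε hs0]
  set B := ProbabilityTheory.beta (1 - β) β with hB
  have hB0 : 0 < B := ProbabilityTheory.beta_pos (by linarith) hβ0
  set F : ℝ → ℝ := fun w => 1 / B * w ^ (-β) * (s ^ (β - 1) * (c - w) ^ (β - 1)) with hF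
  have e1 : ∫⁻ w, ProbabilityTheory.betaPDF (1 - β) β w * stab β (s - ε / (1 - w))
      = ∫⁻ w in Ioo 0 c, ENNReal.ofReal (F w) := by
    rw [← lintegral_indicator measurableSet_Ioo]
    congr 1 with w
    by_cases hw0 : 0 < w
    swap
    · simp [ProbabilityTheory.betaPDF_eq_zero_of_nonpos (not_lt.1 hw0), hw0]
    by_cases hw1 : w < 1
    swap
    · have : ¬ w < c := fun h => hw1 (h.trans hc1)
      simp [ProbabilityTheory.betaPDF_eq_zero_of_one_le (not_lt.1 hw1), this]
    have h1w : 0 < 1 - w := by linarith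
    have hid : s - ε / (1 - w) = s * (c - w) / (1 - w) := by
      rw [hc]; field_simp; ring
    rw [hid]
    by_cases hwc : w < c
    · have hcw : 0 < c - w := by linarith
      rw [stab_of_pos (by positivity), ProbabilityTheory.betaPDF_of_pos_lt_one hw0 hw1,
        indicator_of_mem (show w ∈ Ioo 0 c from ⟨hw0, hwc⟩), ← ENNReal.ofReal_mul (by positivity)]
      congr 1
      rw [hF, Real.div_rpow (by positivity) h1w.le, Real.mul_rpow hs0.le hcw.le]
      have : (1 - w) ^ (β - 1) ≠ 0 := (Real.rpow_pos_of_pos h1w _).ne'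
      rw [show 1 - β - 1 = -β by ring, ← hB]
      field_simp
    · rw [stab_of_nonpos, indicator_of_notMem (fun h => hwc h.2), mul_zero]
      exact div_nonpos_of_nonpos_of_nonneg
        (mul_nonpos_of_nonneg_of_nonpos hs0.le (by linarith)) h1w.le
  have himg : (fun v => c * v) '' Ioo 0 1 = Ioo 0 c := by
    rw [image_mul_left_Ioo hc0]; simp
  rw [e1, ← himg, lintegral_image_eq_lintegral_abs_deriv_mul measurableSet_Ioo
    (f' := fun _ => c) (fun x _ => by simpa using ((hasDerivAt_id x).const_mul c).hasDerivWithinAt)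
    (mul_right_injective₀ hc0.ne').injOn]
  have e2 : ∀ v ∈ Ioo (0 : ℝ) 1, ENNReal.ofReal |c| * ENNReal.ofReal (F (c * v))
      = ENNReal.ofReal (s ^ (β - 1)) *
        ENNReal.ofReal (1 / B * v ^ (1 - β - 1) * (1 - v) ^ (β - 1)) := by
    rintro v ⟨hv0, hv1⟩
    have h1v : 0 < 1 - v := by linarith
    rw [← ENNReal.ofReal_mul (abs_nonneg _), ← ENNReal.ofReal_mul (by positivity),
      abs_of_pos hc0]
    congr 1
    rw [hF]
    simp only
    rw [show c - c * v = c * (1 - v) by ring, Real.mul_rpow hc0.le hv0.le,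
      Real.mul_rpow hc0.le h1v.le, show 1 - β - 1 = -β by ring]
    have : c * c ^ (-β) * c ^ (β - 1) = 1 := by
      rw [← Real.rpow_one_add' hc0.le (by linarith), ← Real.rpow_add hc0,
        show 1 + -β + (β - 1) = 0 by ring, Real.rpow_zero]
    linear_combination (1 / B * v ^ (-β) * s ^ (β - 1) * (1 - v) ^ (β - 1)) * this
  rw [setLIntegral_congr_fun measurableSet_Ioo e2, lintegral_const_mul _ (by fun_prop),
    ← ProbabilityTheory.lintegral_betaPDF,
    ProbabilityTheory.lintegral_betaPDF_eq_one (by linarith) hβ0, mul_one, stab_of_pos hs0]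

/-- The law of the position of a `β`-stable subordinator when it first exceeds level `ε`. -/
lemma exists_firstPassage {β : ℝ} (hβ0 : 0 < β) (hβ1 : β ≤ 1) {ε : ℝ} (hε : 0 < ε) :
    ∃ m : Measure ℝ, IsProbabilityMeasure m ∧ (∀ᵐ r ∂m, 0 < r) ∧
      ∀ s, stab β s = ∫⁻ r, stab β (s - r) ∂m + (Iic ε).indicator (stab β) s := by
  rcases hβ1.eq_or_lt with rfl | hβ1
  · refine ⟨Measure.dirac ε, inferInstance, by simpa using hε, fun s => ?_⟩
    rw [lintegral_dirac]
    by_cases hs : s ≤ ε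
    · simp [hs, stab_of_nonpos]
    · have hs' : ε < s := not_le.1 hs
      simp [hs, stab_of_pos (sub_pos.2 hs'), stab_of_pos (hε.trans hs')]
  · have hβ' : 0 < 1 - β := by linarith
    have := ProbabilityTheory.isProbabilityMeasureBeta hβ' hβ0
    have hmeas : Measurable fun w : ℝ => ε / (1 - w) := by fun_prop
    have hgt : ∀ w : ℝ, 0 < w → w < 1 → ε < ε / (1 - w) := fun w h0 h1 => by
      rw [lt_div_iff₀ (by linarith)]
      nlinarith
    have hpdf : Measurable (ProbabilityTheory.betaPDF (1 - β) β) := by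
      unfold ProbabilityTheory.betaPDF; fun_prop
    refine ⟨(ProbabilityTheory.betaMeasure (1 - β) β).map fun w => ε / (1 - w),
      Measure.isProbabilityMeasure_map hmeas.aemeasurable, ?_, fun s => ?_⟩
    · rw [ae_map_iff hmeas.aemeasurable measurableSet_Ioi, ProbabilityTheory.betaMeasure,
        ae_withDensity_iff hpdf]
      refine ae_of_all _ fun w hw => ?_
      have h1 : w < 1 := by
        by_contra h
        exact hw (ProbabilityTheory.betaPDF_eq_zero_of_one_le (not_lt.1 h))
      exact div_pos hε (by linarith)
    · rw [lintegral_map (by fun_prop) hmeas, ProbabilityTheory.betaMeasure,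
        lintegral_withDensity_eq_lintegral_mul _ hpdf (by fun_prop)]
      simp only [Pi.mul_apply]
      by_cases hs : s ≤ ε
      · rw [indicator_of_mem (show s ∈ Iic ε from hs)]
        suffices ∀ w, ProbabilityTheory.betaPDF (1 - β) β w * stab β (s - ε / (1 - w)) = 0 by
          simp [this]
        intro w
        by_cases hw0 : 0 < w
        · by_cases hw1 : w < 1
          · rw [stab_of_nonpos (by linarith [hgt w hw0 hw1]), mul_zero]
          · rw [ProbabilityTheory.betaPDF_eq_zero_of_one_le (not_lt.1 hw1), zero_mul]
        · rw [ProbabilityTheory.betaPDF_eq_zero_of_nonpos (not_lt.1 hw0), zero_mul]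
      · rw [indicator_of_notMem (show s ∉ Iic ε from hs), add_zero,
          lintegral_betaMeasure_stab hβ0 hβ1 hε (not_le.1 hs)]

/-- The normalizing constant in the Gaussian representation of the Riesz kernel. -/
noncomputable def rieszConst (n : ℕ) (α : ℝ) : ℝ :=
  (2 * Real.pi) ^ (-((n : ℝ) / 2)) * 2 ^ ((n - α) / 2) * Real.Gamma ((n - α) / 2)

lemma rieszConst_pos {α : ℝ} (hα : α < n) : 0 < rieszConst n α := by
  have : 0 < Real.Gamma ((n - α) / 2) := Real.Gamma_pos_of_pos (by linarith)
  unfold rieszConst; positivity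

lemma lintegral_stab_mul_heat (α : ℝ) (x : Rn n) :
    ∫⁻ s, stab (α / 2) s * heat n s x = ∫⁻ s in Ioi (0 : ℝ),
      ENNReal.ofReal ((2 * Real.pi) ^ (-((n : ℝ) / 2)) *
        (s ^ ((α - n) / 2 - 1) * Real.exp (-(1 / (2 * s)) * ‖x‖ ^ 2))) := by
  rw [← lintegral_indicator measurableSet_Ioi]
  congr 1 with s
  by_cases hs : 0 < s
  · rw [indicator_of_mem (show s ∈ Ioi 0 from hs), stab_of_pos hs, heat, if_pos hs,
      ← ENNReal.ofReal_mul (by positivity)]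
    congr 1
    rw [Real.mul_rpow (by positivity) hs.le,
      show (α - n) / 2 - 1 = (α / 2 - 1) + -((n : ℝ) / 2) by ring, Real.rpow_add hs]
    ring
  · rw [indicator_of_notMem (show s ∉ Ioi 0 from hs), stab_of_nonpos (not_lt.1 hs), zero_mul]

/-- The Riesz kernel is a mixture of Gaussian kernels. -/
lemma lintegral_stab_mul_heat_eq_riesz {α : ℝ} (hα : α < n) (x y : Rn n) :
    ∫⁻ s, stab (α / 2) s * heat n s (x - y) = ENNReal.ofReal (rieszConst n α) * riesz n α x y := by
  have hC := rieszConst_pos hα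
  rw [lintegral_stab_mul_heat]
  by_cases hxy : x = y
  · rw [riesz, if_pos hxy, ENNReal.mul_top (by simpa using hC)]
    by_contra hne
    have h : IntegrableOn (fun s : ℝ => (2 * Real.pi) ^ (-((n : ℝ) / 2)) * s ^ ((α - n) / 2 - 1))
        (Ioi 0) := by
      refine ⟨by fun_prop, ?_⟩
      rw [hasFiniteIntegral_iff_ofReal]
      · simpa [hxy] using lt_top_iff_ne_top.2 hne
      · refine (ae_restrict_iff' measurableSet_Ioi).2 (ae_of_all _ fun s hs => ?_)
        have : 0 < s := hs
        positivity
    refine not_integrableOn_Ioi_rpow ((α - n) / 2 - 1) ?_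
    have h2 := h.const_mul ((2 * Real.pi) ^ (-((n : ℝ) / 2)))⁻¹
    refine h2.congr (ae_of_all _ fun s => ?_)
    have : (0 : ℝ) < (2 * Real.pi) ^ (-((n : ℝ) / 2)) := by positivity
    field_simp
  · have hr : 0 < ‖x - y‖ := norm_pos_iff.2 (sub_ne_zero.2 hxy)
    rw [riesz, if_neg hxy]
    set ρ := ‖x - y‖
    have himg : (fun t : ℝ => t⁻¹) '' Ioi 0 = Ioi 0 := by
      ext s
      constructor
      · rintro ⟨t, ht, rfl⟩; exact mem_Ioi.2 (inv_pos.2 (mem_Ioi.1 ht))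
      · intro hs; exact ⟨s⁻¹, mem_Ioi.2 (inv_pos.2 (mem_Ioi.1 hs)), inv_inv s⟩
    rw [← himg, lintegral_image_eq_lintegral_abs_deriv_mul measurableSet_Ioi
      (f' := fun t => -(t ^ 2)⁻¹)
      (fun t ht => (hasDerivAt_inv (ne_of_gt ht)).hasDerivWithinAt) inv_injective.injOn]
    have e : ∀ t ∈ Ioi (0 : ℝ), ENNReal.ofReal |(-(t ^ 2)⁻¹)| *
        ENNReal.ofReal ((2 * Real.pi) ^ (-((n : ℝ) / 2)) *
        (t⁻¹ ^ ((α - n) / 2 - 1) * Real.exp (-(1 / (2 * t⁻¹)) * ρ ^ 2)))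
        = ENNReal.ofReal ((2 * Real.pi) ^ (-((n : ℝ) / 2))) *
          ENNReal.ofReal (t ^ ((n - α) / 2 - 1) * Real.exp (-(ρ ^ 2 / 2 * t))) := by
      intro t ht
      have ht : 0 < t := ht
      rw [← ENNReal.ofReal_mul (abs_nonneg _), ← ENNReal.ofReal_mul (by positivity), abs_neg,
        abs_of_pos (by positivity)]
      congr 1
      rw [Real.inv_rpow ht.le, ← Real.rpow_neg ht.le,
        show t ^ (-((α - n) / 2 - 1)) = t ^ ((n - α) / 2 - 1) * t ^ 2 by
          rw [← Real.rpow_natCast t 2, ← Real.rpow_add ht]; congr 1; push_cast; ring,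
        show -(1 / (2 * t⁻¹)) * ρ ^ 2 = -(ρ ^ 2 / 2 * t) by field_simp]
      field_simp
    have hg := Real.integral_rpow_mul_exp_neg_mul_Ioi (a := (n - α) / 2) (r := ρ ^ 2 / 2)
      (by linarith) (by positivity)
    have hΓ : 0 < Real.Gamma ((n - α) / 2) := Real.Gamma_pos_of_pos (by linarith)
    rw [setLIntegral_congr_fun measurableSet_Ioi e, lintegral_const_mul _ (by fun_prop),
      ← ofReal_integral_eq_lintegral_ofReal, hg, ← ENNReal.ofReal_mul (by positivity),
      ← ENNReal.ofReal_mul hC.le]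
    · congr 1
      rw [rieszConst, one_div_div, Real.div_rpow (by positivity) (by positivity),
        ← Real.rpow_natCast ρ 2, ← Real.rpow_mul hr.le,
        show ((2 : ℕ) : ℝ) * ((n - α) / 2) = n - α by push_cast; ring,
        show α - n = -(n - α) by ring, Real.rpow_neg hr.le]
      ring
    · by_contra hni
      rw [integral_undef hni] at hg
      have : 0 < (1 / (ρ ^ 2 / 2)) ^ ((n - α) / 2) * Real.Gamma ((n - α) / 2) := by positivity
      linarith
    · refine (ae_restrict_iff' measurableSet_Ioi).2 (ae_of_all _ fun s hs => ?_)
      have : 0 < s := hs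
      exact mul_nonneg (Real.rpow_nonneg this.le _) (Real.exp_pos _).le

lemma lowerSemicontinuous_lintegral {X Y : Type*} [TopologicalSpace X] [FirstCountableTopology X]
    [MeasurableSpace Y] {ρ : Measure Y} {f : X → Y → ℝ≥0∞} (hf : ∀ x, Measurable (f x))
    (h : ∀ y, LowerSemicontinuous fun x => f x y) :
    LowerSemicontinuous fun x => ∫⁻ y, f x y ∂ρ := by
  rw [lowerSemicontinuous_iff_le_liminf]
  intro x
  calc ∫⁻ y, f x y ∂ρ ≤ ∫⁻ y, liminf (fun x' => f x' y) (𝓝 x) ∂ρ :=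
        lintegral_mono fun y => (h y).le_liminf x
    _ ≤ _ := lintegral_liminf_le hf

/-- The potential of `μ` with respect to the subordinated Gaussian kernel. -/
noncomputable def pot (β : ℝ) (μ : Measure (Rn n)) (x : Rn n) : ℝ≥0∞ :=
  ∫⁻ s, stab β s * smooth μ s x

/-- The part of `pot` coming from times at most `ε`. -/
noncomputable def shortPot (β ε : ℝ) (μ : Measure (Rn n)) (x : Rn n) : ℝ≥0∞ :=
  ∫⁻ s in Iic ε, stab β s * smooth μ s x

@[fun_prop]
lemma measurable_pot (β : ℝ) (μ : Measure (Rn n)) [SFinite μ] : Measurable (pot β μ) := by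
  unfold pot
  exact Measurable.lintegral_prod_right'
    (f := fun p : Rn n × ℝ => stab β p.2 * smooth μ p.2 p.1) (by fun_prop)

@[fun_prop]
lemma measurable_shortPot (β ε : ℝ) (μ : Measure (Rn n)) [SFinite μ] :
    Measurable (shortPot β ε μ) := by
  unfold shortPot
  exact Measurable.lintegral_prod_right'
    (f := fun p : Rn n × ℝ => stab β p.2 * smooth μ p.2 p.1) (by fun_prop)

lemma pot_eq_potential {α : ℝ} (hα : α < n) (μ : Measure (Rn n)) [SFinite μ] (x : Rn n) :
    pot (α / 2) μ x = ENNReal.ofReal (rieszConst n α) * potential (riesz n α) μ x := by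
  have h : ∀ s, stab (α / 2) s * smooth μ s x = ∫⁻ y, stab (α / 2) s * heat n s (x - y) ∂μ :=
    fun s => (lintegral_const_mul _ (by fun_prop)).symm
  unfold pot potential
  simp_rw [h]
  rw [lintegral_lintegral_swap (by fun_prop)]
  simp_rw [lintegral_stab_mul_heat_eq_riesz hα]
  exact lintegral_const_mul' _ _ ENNReal.ofReal_ne_top

lemma lowerSemicontinuous_smooth (μ : Measure (Rn n)) (s : ℝ) :
    LowerSemicontinuous (smooth μ s) :=
  lowerSemicontinuous_lintegral (f := fun x y => heat n s (x - y)) (fun x => by fun_prop)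
    fun y => ((continuous_heat s).comp (continuous_id.sub continuous_const)).lowerSemicontinuous

lemma lowerSemicontinuous_pot (β : ℝ) (μ : Measure (Rn n)) [SFinite μ] :
    LowerSemicontinuous (pot β μ) := by
  have hst : ∀ s, stab β s ≠ ⊤ := fun s => by
    unfold stab; split_ifs <;> simp
  exact lowerSemicontinuous_lintegral (f := fun x s => stab β s * smooth μ s x)
    (fun x => by fun_prop) fun s =>
    (ENNReal.continuous_const_mul (hst s)).comp_lowerSemicontinuous
      (lowerSemicontinuous_smooth μ s) fun a b h => by dsimp only; gcongr

lemma lintegral_pot (β : ℝ) (μ ν : Measure (Rn n)) [SFinite μ] [SFinite ν] :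
    ∫⁻ x, pot β ν x ∂μ = ∫⁻ s, stab β s * ∫⁻ x, smooth ν s x ∂μ := by
  unfold pot
  rw [lintegral_lintegral_swap (by fun_prop)]
  congr 1 with s
  rw [lintegral_const_mul _ (by fun_prop)]

lemma lintegral_pot_comm (β : ℝ) (μ ν : Measure (Rn n)) [SFinite μ] [SFinite ν] :
    ∫⁻ x, pot β ν x ∂μ = ∫⁻ x, pot β μ x ∂ν := by
  simp_rw [lintegral_pot, lintegral_smooth_comm μ ν]

lemma smoothF_pot (β : ℝ) (μ : Measure (Rn n)) [SFinite μ] {r : ℝ} (hr : 0 < r) (x : Rn n) :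
    smoothF (pot β μ) r x = ∫⁻ s, stab β s * smooth μ (r + s) x := by
  unfold smoothF pot
  simp_rw [fun y => (lintegral_const_mul (μ := volume) (heat n r (x - y))
      (show Measurable fun s => stab β s * smooth μ s y by fun_prop)).symm]
  rw [lintegral_lintegral_swap (by fun_prop)]
  congr 1 with s
  simp_rw [mul_left_comm _ (stab β s)]
  rw [lintegral_const_mul _ (by fun_prop)]
  by_cases hs : 0 < s
  · rw [← smoothF_smooth μ hr hs]; rfl
  · simp [stab, hs]

lemma lintegral_smoothF_pot_le (β : ℝ) (μ : Measure (Rn n)) [SFinite μ] {r : ℝ} (hr : 0 < r) :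
    ∫⁻ x, smoothF (pot β μ) r x ∂μ ≤ ∫⁻ x, pot β μ x ∂μ := by
  simp_rw [smoothF_pot β μ hr]
  rw [lintegral_pot, lintegral_lintegral_swap (by fun_prop)]
  refine lintegral_mono fun s => ?_
  rw [lintegral_const_mul _ (by fun_prop)]
  by_cases hs : 0 < s
  · exact mul_le_mul' le_rfl (lintegral_smooth_add_le μ hr hs)
  · simp [stab, hs]

lemma pot_eq_lintegral_smoothF_add {β ε : ℝ} {m : Measure ℝ} [SFinite m]
    (hm : ∀ᵐ r ∂m, 0 < r)
    (h : ∀ s, stab β s = ∫⁻ r, stab β (s - r) ∂m + (Iic ε).indicator (stab β) s)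
    (μ : Measure (Rn n)) [SFinite μ] (x : Rn n) :
    pot β μ x = ∫⁻ r, smoothF (pot β μ) r x ∂m + shortPot β ε μ x := by
  have h1 : ∀ s, stab β s * smooth μ s x = ∫⁻ r, stab β (s - r) * smooth μ s x ∂m +
      (Iic ε).indicator (fun s => stab β s * smooth μ s x) s := by
    intro s
    rw [lintegral_mul_const _ (by fun_prop)]
    conv_lhs => rw [h s]
    rw [add_mul, indicator_mul_left]
  calc pot β μ x = ∫⁻ s, (∫⁻ r, stab β (s - r) * smooth μ s x ∂m +
      (Iic ε).indicator (fun s => stab β s * smooth μ s x) s) := lintegral_congr h1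
    _ = _ := ?_
  rw [lintegral_add_right _ ((by fun_prop : Measurable fun s => stab β s * smooth μ s x).indicator
    measurableSet_Iic), lintegral_indicator measurableSet_Iic]
  congr 1
  rw [lintegral_lintegral_swap (by fun_prop)]
  refine lintegral_congr_ae (hm.mono fun r hr => ?_)
  beta_reduce
  rw [smoothF_pot β μ hr]
  rw [← lintegral_add_left_eq_self (fun s => stab β (s - r) * smooth μ s x) r]
  simp

lemma smoothF_eq_lintegral_scaled {v : Rn n → ℝ≥0∞} (hv : Measurable v) {s : ℝ} (hs : 0 < s)
    (x : Rn n) : smoothF v s x = ∫⁻ z, heat n 1 z * v (x - √s • z) := by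
  have h0 : √s ≠ 0 := (Real.sqrt_pos.2 hs).ne'
  have h1 : ∫⁻ z, heat n 1 z * v (x - √s • z)
      = ∫⁻ y, heat n 1 ((√s)⁻¹ • y) * v (x - y) ∂(Measure.map (fun z : Rn n => √s • z) volume) := by
    rw [lintegral_map (by fun_prop) (by fun_prop)]
    simp [smul_smul, h0]
  rw [h1, Measure.map_addHaar_smul _ h0, lintegral_smul_measure]
  rw [smul_eq_mul, ← lintegral_const_mul _ (by fun_prop)]
  unfold smoothF
  rw [← lintegral_sub_left_eq_self (fun y => heat n s (x - y) * v y) x]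
  simp_rw [sub_sub_cancel x]
  congr 1 with y
  rw [← mul_assoc]
  congr 1
  simp only [heat, hs, if_true, zero_lt_one, finrank_euclideanSpace, Fintype.card_fin]
  rw [← ENNReal.ofReal_mul (by positivity)]
  congr 1
  rw [norm_smul, Real.norm_eq_abs, mul_pow, sq_abs, inv_pow, Real.sq_sqrt hs.le,
    abs_of_nonneg (by positivity), ← mul_assoc, Real.mul_rpow (by positivity) hs.le, mul_one]
  have : s ^ (-((n : ℝ) / 2)) = (√s ^ n)⁻¹ := by
    rw [Real.sqrt_eq_rpow, ← Real.rpow_natCast, ← Real.rpow_mul hs.le, ← Real.rpow_neg hs.le]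
    congr 1; ring
  rw [this, mul_comm ((√s ^ n)⁻¹)]
  congr 2
  field_simp

lemma le_liminf_smoothF {v : Rn n → ℝ≥0∞} (hv : LowerSemicontinuous v) (x : Rn n) :
    v x ≤ liminf (fun s => smoothF v s x) (𝓝[>] (0 : ℝ)) := by
  have hvm : Measurable v := hv.measurable
  calc v x = ∫⁻ z, heat n 1 z * v x := by
        rw [lintegral_mul_const _ (by fun_prop), lintegral_heat one_pos, one_mul]
    _ ≤ ∫⁻ z, liminf (fun s : ℝ => heat n 1 z * v (x - √s • z)) (𝓝[>] 0) := by
        refine lintegral_mono fun z => ?_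
        have ht : heat n 1 z ≠ ⊤ := ((heat_le 1 z).trans_lt ofReal_lt_top).ne
        have hg : LowerSemicontinuous fun s : ℝ => heat n 1 z * v (x - √s • z) :=
          (ENNReal.continuous_const_mul ht).comp_lowerSemicontinuous
            (hv.comp (g := fun s : ℝ => x - √s • z) (by fun_prop)) fun a b h => by
              dsimp only; gcongr
        have h1 := hg.le_liminf 0
        simp only [Real.sqrt_zero, zero_smul, sub_zero] at h1
        exact h1.trans (liminf_le_liminf_of_le nhdsWithin_le_nhds)
    _ ≤ liminf (fun s : ℝ => ∫⁻ z, heat n 1 z * v (x - √s • z)) (𝓝[>] 0) :=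
        lintegral_liminf_le fun s => by fun_prop
    _ = _ := liminf_congr (eventually_mem_nhdsWithin.mono fun s hs =>
        (smoothF_eq_lintegral_scaled hvm hs x).symm)

lemma lintegral_le_liminf_smoothF {v : Rn n → ℝ≥0∞} (hv : LowerSemicontinuous v)
    (ρ : Measure (Rn n)) :
    ∫⁻ x, v x ∂ρ ≤ liminf (fun s => ∫⁻ x, smoothF v s x ∂ρ) (𝓝[>] (0 : ℝ)) := by
  have := hv.measurable
  exact (lintegral_mono fun x => le_liminf_smoothF hv x).trans
    (lintegral_liminf_le fun s => by fun_prop)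

lemma lintegral_stab_tail_lt_top {β : ℝ} (hβn : β < n / 2) :
    ∫⁻ s in Ioi (1 : ℝ), stab β s * ENNReal.ofReal ((2 * Real.pi * s) ^ (-((n : ℝ) / 2))) < ⊤ := by
  have h : IntegrableOn (fun s : ℝ => (2 * Real.pi) ^ (-((n : ℝ) / 2)) * s ^ (β - 1 - n / 2))
      (Ioi 1) :=
    (integrableOn_Ioi_rpow_of_lt (by linarith) one_pos).const_mul _
  refine lt_of_eq_of_lt (setLIntegral_congr_fun measurableSet_Ioi fun s hs => ?_)
    h.lintegral_lt_top
  have hs0 : (0 : ℝ) < s := one_pos.trans hs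
  rw [stab_of_pos hs0, ← ENNReal.ofReal_mul (by positivity), Real.mul_rpow (by positivity) hs0.le,
    sub_eq_add_neg (β - 1), Real.rpow_add hs0]
  congr 1; ring

lemma exists_pot_restrict_le {β : ℝ} (hβ : 0 < β) (hβn : β < n / 2) {D : Set (Rn n)}
    (hD : MeasurableSet D) (hvol : volume D < ⊤) :
    ∃ C : ℝ≥0∞, C ≠ ⊤ ∧ ∀ x, pot β (volume.restrict D) x ≤ C := by
  refine ⟨(∫⁻ s in Iic 1, stab β s) + (∫⁻ s in Ioi (1 : ℝ), stab β s *
    ENNReal.ofReal ((2 * Real.pi * s) ^ (-((n : ℝ) / 2)))) * volume D, ?_, fun x => ?_⟩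
  · exact ENNReal.add_ne_top.2 ⟨(lintegral_stab_Iic_lt_top hβ one_pos).ne,
      (ENNReal.mul_lt_top (lintegral_stab_tail_lt_top hβn) hvol).ne⟩
  · unfold pot
    rw [← lintegral_add_compl _ measurableSet_Iic (μ := volume) (A := Iic (1 : ℝ)), compl_Iic,
      ← lintegral_mul_const _ (by fun_prop)]
    refine add_le_add (lintegral_mono fun s => ?_) (lintegral_mono fun s => ?_)
    · refine (mul_le_mul' le_rfl ?_).trans_eq (mul_one _)
      rw [smooth_restrict D hD]
      exact smoothF_le_of_le (fun y => indicator_le_self' (by simp) y) s x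
    · rw [mul_assoc]
      gcongr
      calc smooth (volume.restrict D) s x
          ≤ ∫⁻ y in D, ENNReal.ofReal ((2 * Real.pi * s) ^ (-((n : ℝ) / 2))) :=
            lintegral_mono fun y => heat_le s _
        _ = _ := by simp

lemma lintegral_shortPot {β ε : ℝ} (μ ν : Measure (Rn n)) [SFinite μ] [SFinite ν] :
    ∫⁻ x, shortPot β ε ν x ∂μ = ∫⁻ s in Iic ε, stab β s * ∫⁻ x, smooth ν s x ∂μ := by
  unfold shortPot
  rw [lintegral_lintegral_swap (by fun_prop)]
  congr 1 with s
  rw [lintegral_const_mul _ (by fun_prop)]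

/-- The short-time inequality behind the maximum principle. -/
lemma lintegral_excess_shortPot_le {β ε : ℝ} (hβ0 : 0 < β) (hβ1 : β ≤ 1)
    (hε : 0 < ε) (μ : Measure (Rn n)) [SFinite μ] {b : ℝ≥0∞}
    {C : ℝ≥0∞} (hC : ∀ x, pot β (volume.restrict {x | b < pot β μ x}) x ≤ C)
    (hfin : C * ∫⁻ x, (pot β μ x - b) ≠ ⊤) :
    ∫⁻ x, (pot β μ x - b) * shortPot β ε (volume.restrict {x | b < pot β μ x}) x
      ≤ C * ∫⁻ x in {x | b < pot β μ x}, shortPot β ε μ x := by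
  obtain ⟨m, hm, hm0, hdec⟩ := exists_firstPassage hβ0 hβ1 hε
  set D := {x | b < pot β μ x} with hD
  have hDm : MeasurableSet D := measurableSet_lt measurable_const (measurable_pot β μ)
  set τ := volume.restrict D with hτ
  set d : Rn n → ℝ≥0∞ := fun x => pot β μ x - b with hd
  have hdm : Measurable d := (measurable_pot β μ).sub measurable_const
  set P : (Rn n → ℝ≥0∞) → Rn n → ℝ≥0∞ := fun v x => ∫⁻ r, smoothF v r x ∂m with hP
  have hPm : ∀ {v : Rn n → ℝ≥0∞}, Measurable v → Measurable (P v) := fun {v} hv =>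
    Measurable.lintegral_prod_right' (f := fun p : Rn n × ℝ => smoothF v p.2 p.1) (by fun_prop)
  have hPsymm : ∀ {v w : Rn n → ℝ≥0∞}, Measurable v → Measurable w →
      ∫⁻ x, P v x * w x = ∫⁻ x, v x * P w x := by
    intro v w hv hw
    simp only [hP]
    simp_rw [fun x => (lintegral_mul_const (μ := m) (w x)
      (show Measurable fun r => smoothF v r x by fun_prop)).symm,
      fun x => (lintegral_const_mul (μ := m) (v x)
      (show Measurable fun r => smoothF w r x by fun_prop)).symm]
    calc _ = ∫⁻ r, ∫⁻ x, smoothF v r x * w x ∂volume ∂m := lintegral_lintegral_swap (by fun_prop)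
      _ = ∫⁻ r, ∫⁻ x, v x * smoothF w r x ∂volume ∂m := by simp_rw [lintegral_mul_smoothF hv hw]
      _ = _ := (lintegral_lintegral_swap (by fun_prop)).symm
  have hdec' : ∀ (σ : Measure (Rn n)) [SFinite σ] (x : Rn n),
      pot β σ x = P (pot β σ) x + shortPot β ε σ x := fun σ _ x =>
    pot_eq_lintegral_smoothF_add hm0 hdec σ x
  have hle : ∀ x, d x ≤ P d x + D.indicator (shortPot β ε μ) x := by
    intro x
    by_cases hx : x ∈ D
    · rw [indicator_of_mem hx]
      have h1 : pot β μ = fun x => d x + min (pot β μ x) b := by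
        ext y; exact (tsub_add_min).symm
      have h2 : P (pot β μ) x ≤ P d x + b := by
        conv_lhs => rw [h1]
        simp only [hP]
        simp_rw [smoothF_add hdm]
        rw [lintegral_add_left (by fun_prop)]
        gcongr
        calc ∫⁻ r, smoothF (fun y => min (pot β μ y) b) r x ∂m ≤ ∫⁻ r, b ∂m :=
              lintegral_mono fun r => smoothF_le_of_le (fun y => min_le_right _ _) r x
          _ = b := by simp
      have h3 := hdec' μ x
      rw [hd]; dsimp only
      rw [tsub_le_iff_right, h3]
      calc _ ≤ P d x + b + shortPot β ε μ x := by gcongr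
        _ = _ := by ring
    · have : d x = 0 := tsub_eq_zero_of_le (not_lt.1 hx)
      simp [this]
  have hPd : ∫⁻ x, d x * P (pot β τ) x ≠ ⊤ := by
    refine ne_top_of_le_ne_top hfin ?_
    rw [mul_comm, ← lintegral_mul_const _ hdm]
    refine lintegral_mono fun x => ?_
    gcongr
    calc P (pot β τ) x ≤ ∫⁻ r, C ∂m := lintegral_mono fun r => smoothF_le_of_le hC r x
      _ = C := by simp
  have h1 : ∫⁻ x, d x * pot β τ x
      = (∫⁻ x, d x * P (pot β τ) x) + ∫⁻ x, d x * shortPot β ε τ x := by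
    rw [← lintegral_add_left (f := fun x => d x * P (pot β τ) x)
      (hdm.mul (hPm (measurable_pot β τ)))]
    congr 1 with x
    rw [← mul_add, ← hdec']
  have h2 : ∫⁻ x, d x * pot β τ x
      ≤ (∫⁻ x, d x * P (pot β τ) x) + C * ∫⁻ x in D, shortPot β ε μ x := by
    rw [← hPsymm hdm (measurable_pot β τ), ← lintegral_indicator hDm,
      ← lintegral_const_mul _ ((measurable_shortPot β ε μ).indicator hDm),
      ← lintegral_add_left (f := fun x => P d x * pot β τ x) ((hPm hdm).mul (measurable_pot β τ))]
    refine lintegral_mono fun x => ?_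
    calc d x * pot β τ x ≤ (P d x + D.indicator (shortPot β ε μ) x) * pot β τ x := by
          gcongr; exact hle x
      _ ≤ P d x * pot β τ x + C * D.indicator (shortPot β ε μ) x := by
          rw [add_mul, mul_comm C]; gcongr; exact hC x
  rw [h1] at h2
  exact (ENNReal.add_le_add_iff_left hPd).1 h2

/-- Maximum principle for the subordinated Gaussian kernel. -/
theorem pot_le_of_ae_le {β : ℝ} (hβ0 : 0 < β) (hβ1 : β ≤ 1) (hβn : β < n / 2)
    (μ : Measure (Rn n)) [IsFiniteMeasure μ] {a : ℝ≥0∞} (ha : a ≠ ⊤)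
    (hvol : ∀ b, a < b → volume {x | b < pot β μ x} < ⊤)
    (hae : ∀ᵐ x ∂μ, pot β μ x ≤ a) (x : Rn n) : pot β μ x ≤ a := by
  by_contra! hx
  obtain ⟨b, hab, hbx⟩ := exists_between hx
  have hb : b ≠ ⊤ := hbx.ne_top
  have hη : b - a ≠ 0 := (tsub_pos_of_lt hab).ne'
  set u := pot β μ with hu
  have hum : Measurable u := measurable_pot β μ
  have hlsc : LowerSemicontinuous u := lowerSemicontinuous_pot β μ
  set D := {x | b < u x} with hD
  have hDo : IsOpen D := hlsc.isOpen_preimage b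
  have hDm : MeasurableSet D := hDo.measurableSet
  set τ := volume.restrict D with hτ
  obtain ⟨C, hCt, hC⟩ := exists_pot_restrict_le hβ0 hβn hDm (hvol b hab)
  have hfin : ∫⁻ x, (u x - b) ≠ ⊤ := by
    have : ∫⁻ x, (u x - b) ≤ C * μ univ := by
      calc ∫⁻ x, (u x - b) ≤ ∫⁻ x, D.indicator u x := by
            refine lintegral_mono fun y => ?_
            by_cases hy : y ∈ D
            · rw [indicator_of_mem hy]; exact tsub_le_self
            · rw [tsub_eq_zero_of_le (not_lt.1 hy)]; exact zero_le
        _ = ∫⁻ x, u x ∂τ := lintegral_indicator hDm _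
        _ = ∫⁻ x, pot β τ x ∂μ := lintegral_pot_comm β τ μ
        _ ≤ ∫⁻ x, C ∂μ := lintegral_mono hC
        _ = _ := by simp
    exact ne_top_of_le_ne_top (ENNReal.mul_ne_top hCt (measure_ne_top μ _)) this
  set l := ∫⁻ x, (u x - b) with hl
  have hl0 : l ≠ 0 := by
    intro h0
    rw [hl, lintegral_eq_zero_iff (by fun_prop)] at h0
    have h1 : volume D = 0 := by
      refine measure_mono_null (fun y hy => ?_) h0
      exact (tsub_pos_of_lt hy).ne'
    exact (hDo.measure_pos volume ⟨x, hbx⟩).ne' h1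
  set L : ℝ → ℝ≥0∞ := fun s => ∫⁻ x, (u x - b) * smooth τ s x with hL
  have hind : LowerSemicontinuous (D.indicator (1 : Rn n → ℝ≥0∞)) :=
    hDo.lowerSemicontinuous_indicator zero_le_one
  have hLlim : ∀ᶠ s in 𝓝[>] (0 : ℝ), l / 2 < L s := by
    have h1 := lintegral_le_liminf_smoothF hind (volume.withDensity fun x => u x - b)
    refine eventually_lt_of_lt_liminf (lt_of_lt_of_le (ENNReal.half_lt_self hl0 hfin)
      (le_trans (le_of_eq ?_) (h1.trans (le_of_eq ?_))))
    · rw [lintegral_withDensity_eq_lintegral_mul _ (by fun_prop)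
        (measurable_one.indicator hDm)]
      refine lintegral_congr fun y => ?_
      by_cases hy : y ∈ D
      · simp [hy]
      · simp [hy, tsub_eq_zero_of_le (show u y ≤ b from not_lt.1 hy)]
    · congr 1 with s
      have hm1 : Measurable (D.indicator (1 : Rn n → ℝ≥0∞)) := measurable_one.indicator hDm
      rw [lintegral_withDensity_eq_lintegral_mul _ (by fun_prop) (by fun_prop)]
      refine lintegral_congr fun y => ?_
      simp [hτ, smooth_restrict D hDm]
  set R : ℝ → ℝ≥0∞ := fun s => ∫⁻ x, smooth τ s x ∂μ with hR
  have hE : ∫⁻ x, u x ∂μ ≠ ⊤ := by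
    refine ne_top_of_le_ne_top (ENNReal.mul_ne_top ha (measure_ne_top μ univ)) ?_
    calc ∫⁻ x, u x ∂μ ≤ ∫⁻ x, a ∂μ := lintegral_mono_ae hae
      _ = _ := by simp
  set E := ∫⁻ x, u x ∂μ with hEdef
  have hRlim : ∀ δ : ℝ≥0∞, 0 < δ → ∀ᶠ s in 𝓝[>] (0 : ℝ), (b - a) * R s ≤ δ := by
    intro δ hδ
    set B : ℝ → ℝ≥0∞ := fun s => ∫⁻ x, smoothF (fun y => min (u y) a) s x ∂μ with hB
    have hminlsc : LowerSemicontinuous fun y => min (u y) a :=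
      hlsc.inf lowerSemicontinuous_const
    have hBlim : ∀ᶠ s in 𝓝[>] (0 : ℝ), E ≤ B s + δ := by
      by_cases hEδ : E ≤ δ
      · exact Eventually.of_forall fun s => hEδ.trans le_add_self
      · have h1 := lintegral_le_liminf_smoothF hminlsc μ
        have h2 : ∫⁻ y, min (u y) a ∂μ = E :=
          lintegral_congr_ae (hae.mono fun y hy => min_eq_left hy)
        rw [h2] at h1
        have h3 : E - δ < E := ENNReal.sub_lt_self hE (fun h => hEδ (by simp [h])) hδ.ne'
        filter_upwards [eventually_lt_of_lt_liminf (h3.trans_le h1)] with s hs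
        exact tsub_le_iff_right.1 hs.le
    filter_upwards [hBlim, eventually_mem_nhdsWithin] with s hs hs0
    have hs0 : 0 < s := hs0
    have hBm : Measurable fun y => min (u y) a := by fun_prop
    have hsum : (∫⁻ x, smoothF (fun y => u y - a) s x ∂μ) + B s ≤ E := by
      rw [hB, ← lintegral_add_left (by fun_prop)]
      refine le_trans (le_of_eq ?_) (lintegral_smoothF_pot_le β μ hs0)
      refine lintegral_congr fun y => ?_
      rw [← smoothF_add (by fun_prop)]
      congr 1 with z
      exact tsub_add_min
    have hBfin : B s ≠ ⊤ := ne_top_of_le_ne_top hE (le_add_self.trans hsum)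
    have h4 : ∫⁻ x, smoothF (fun y => u y - a) s x ∂μ ≤ δ := by
      have := hsum.trans hs
      rw [add_comm (B s)] at this
      exact (ENNReal.add_le_add_iff_right hBfin).1 this
    refine le_trans ?_ h4
    rw [hR]; dsimp only
    rw [← lintegral_const_mul _ (by fun_prop)]
    refine lintegral_mono fun y => ?_
    rw [hτ, smooth_restrict D hDm, ← smoothF_const_mul (measurable_one.indicator hDm)]
    refine smoothF_mono (fun z => ?_) s y
    by_cases hz : z ∈ D
    · simp only [hz, indicator_of_mem, Pi.one_apply, mul_one]
      exact tsub_le_tsub_right (le_of_lt hz) a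
    · simp [hz]
  set δ := (b - a) * (l / 4) / (C + 1) with hδdef
  have hC1 : C + 1 ≠ ⊤ := ENNReal.add_ne_top.2 ⟨hCt, one_ne_top⟩
  have hba : b - a ≠ ⊤ := ENNReal.sub_ne_top hb
  have hδ : 0 < δ := ENNReal.div_pos (mul_ne_zero hη (ENNReal.div_pos hl0 (by norm_num)).ne') hC1
  have hev := hLlim.and (hRlim δ hδ)
  obtain ⟨ε, hε, hεs⟩ := (mem_nhdsGT_iff_exists_Ioc_subset).1 hev
  have hε : 0 < ε := hε
  have key := lintegral_excess_shortPot_le hβ0 hβ1 hε μ hC (ENNReal.mul_ne_top hCt hfin)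
  have hlhs : ∫⁻ s in Iic ε, stab β s * (l / 2)
      ≤ ∫⁻ x, (u x - b) * shortPot β ε τ x := by
    have h1 : ∫⁻ x, (u x - b) * shortPot β ε τ x = ∫⁻ s in Iic ε, stab β s * L s := by
      have := lintegral_shortPot (β := β) (ε := ε) (volume.withDensity fun x => u x - b) τ
      rw [lintegral_withDensity_eq_lintegral_mul _ (by fun_prop) (by fun_prop)] at this
      refine this.trans ?_
      congr 1 with s
      rw [lintegral_withDensity_eq_lintegral_mul _ (by fun_prop) (by fun_prop)]
      rfl
    rw [h1]
    refine setLIntegral_mono' measurableSet_Iic fun s hs => ?_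
    by_cases hs0 : 0 < s
    · gcongr; exact (hεs ⟨hs0, hs⟩).1.le
    · simp [stab, hs0]
  have hrhs : C * ∫⁻ x in D, shortPot β ε μ x ≤ ∫⁻ s in Iic ε, stab β s * (l / 4) := by
    have h1 : ∫⁻ x in D, shortPot β ε μ x = ∫⁻ s in Iic ε, stab β s * R s := by
      have := lintegral_shortPot (β := β) (ε := ε) τ μ
      refine this.trans ?_
      congr 1 with s
      rw [lintegral_smooth_comm]
    have hRm : Measurable R :=
      Measurable.lintegral_prod_right' (f := fun p : ℝ × Rn n => smooth τ p.1 p.2) (by fun_prop)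
    rw [h1, ← lintegral_const_mul _ (by fun_prop)]
    refine setLIntegral_mono' measurableSet_Iic fun s hs => ?_
    rw [mul_left_comm]
    by_cases hs0 : 0 < s
    · gcongr
      have h2 : (b - a) * R s ≤ δ := (hεs ⟨hs0, hs⟩).2
      have h3 : R s ≤ l / 4 / (C + 1) := by
        rw [← ENNReal.mul_le_mul_iff_right hη hba, ← mul_div_assoc]
        exact h2
      calc C * R s ≤ (C + 1) * (l / 4 / (C + 1)) := by gcongr; exact le_self_add
        _ = l / 4 := ENNReal.mul_div_cancel (by simp) hC1
    · simp [stab, hs0]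
  have h5 := hlhs.trans (key.trans hrhs)
  rw [lintegral_mul_const _ (by fun_prop), lintegral_mul_const _ (by fun_prop),
    ENNReal.mul_le_mul_iff_right (lintegral_stab_Iic_pos β hε).ne'
      (lintegral_stab_Iic_lt_top hβ0 hε).ne] at h5
  have h6 : l / 4 < l / 2 := by
    have : l / 4 = l / 2 / 2 := by
      rw [div_eq_mul_inv, div_eq_mul_inv, div_eq_mul_inv, mul_assoc,
        ← ENNReal.mul_inv (by simp) (by simp)]
      norm_num
    rw [this]
    exact ENNReal.half_lt_self (ENNReal.div_pos hl0 (by simp)).ne'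
      (ENNReal.div_lt_top hfin (by simp)).ne
  exact absurd h5 (not_le.2 h6)

lemma riesz_symm (α : ℝ) (x y : Rn n) : riesz n α x y = riesz n α y x := by
  simp [riesz, eq_comm, norm_sub_rev]

@[fun_prop]
lemma Measurable.riesz {Y : Type*} [MeasurableSpace Y] (α : ℝ) {f g : Y → Rn n}
    (hf : Measurable f) (hg : Measurable g) : Measurable fun y => riesz n α (f y) (g y) := by
  unfold Balayage.riesz
  exact Measurable.ite (measurableSet_eq_fun hf hg) measurable_const (by fun_prop)

@[fun_prop]
lemma measurable_potential (α : ℝ) (μ : Measure (Rn n)) [SFinite μ] :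
    Measurable (potential (riesz n α) μ) := by
  unfold potential
  exact Measurable.lintegral_prod_right' (f := fun p : Rn n × Rn n => riesz n α p.1 p.2)
    (by fun_prop)

lemma energy_comm (α : ℝ) (μ ν : Measure (Rn n)) [SFinite μ] [SFinite ν] :
    energy (riesz n α) μ ν = energy (riesz n α) ν μ := by
  unfold energy potential
  rw [lintegral_lintegral_swap (by fun_prop)]
  simp_rw [riesz_symm]

lemma riesz_le_of_le {α : ℝ} (hα : α < n) {x y : Rn n} {T : ℝ} (hT : 0 < T) (h : T ≤ ‖x - y‖) :
    riesz n α x y ≤ ENNReal.ofReal (T ^ (α - n)) := by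
  have hxy : x ≠ y := fun e => by simp [e] at h; linarith
  rw [riesz, if_neg hxy]
  exact ENNReal.ofReal_le_ofReal (Real.rpow_le_rpow_of_nonpos hT h (by linarith))

lemma le_riesz_of_le {α : ℝ} (hα : α < n) {x y : Rn n} {T : ℝ} (h : ‖x - y‖ ≤ T) :
    ENNReal.ofReal (T ^ (α - n)) ≤ riesz n α x y := by
  unfold riesz
  split_ifs with hxy
  · exact le_top
  · exact ENNReal.ofReal_le_ofReal (Real.rpow_le_rpow_of_nonpos
      (norm_pos_iff.2 (sub_ne_zero.2 hxy)) h (by linarith))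

/-- Frostman's maximum principle for the Riesz kernel. -/
theorem potential_le_one_of_ae {α : ℝ} (hα0 : 0 < α) (hα2 : α ≤ 2) (hαn : α < n)
    (μ : Measure (Rn n)) [IsFiniteMeasure μ] {R : ℝ} (hR : μ (Metric.closedBall 0 R)ᶜ = 0)
    (h : ∀ᵐ x ∂μ, potential (riesz n α) μ x ≤ 1) (x : Rn n) : potential (riesz n α) μ x ≤ 1 := by
  set c := ENNReal.ofReal (rieszConst n α) with hc
  have hc0 : c ≠ 0 := by simpa [hc] using rieszConst_pos hαn
  have hct : c ≠ ⊤ := ENNReal.ofReal_ne_top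
  have hpot : ∀ x, pot (α / 2) μ x = c * potential (riesz n α) μ x := pot_eq_potential hαn μ
  have key : pot (α / 2) μ x ≤ c := by
    refine pot_le_of_ae_le (by linarith) (by linarith) (by linarith) μ hct (fun b hb => ?_)
      (h.mono fun y hy => ?_) x
    · have hb0 : 0 < b := zero_le.trans_lt hb
      have hlim : Tendsto (fun T : ℝ => c * (ENNReal.ofReal (T ^ (α - n)) * μ univ)) atTop
          (𝓝 0) := by
        have h1 : Tendsto (fun T : ℝ => T ^ (α - n)) atTop (𝓝 0) := by
          simpa using tendsto_rpow_neg_atTop (y := n - α) (by linarith)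
        have h2 := ENNReal.Tendsto.mul_const (b := μ univ) (ENNReal.tendsto_ofReal h1)
          (Or.inr (measure_ne_top μ _))
        have h3 := ENNReal.Tendsto.const_mul (a := c) h2 (Or.inr hct)
        simpa using h3
      obtain ⟨T, hT, hT0⟩ := ((hlim.eventually_lt_const hb0).and (eventually_gt_atTop 0)).exists
      refine (measure_mono (fun y hy => ?_)).trans_lt
        (measure_closedBall_lt_top (x := (0 : Rn n)) (r := R + T))
      by_contra hy'
      have hyn : R + T < ‖y‖ := by simpa using hy'
      refine absurd hy (not_lt.2 (le_trans ?_ hT.le))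
      rw [hpot]
      gcongr
      calc potential (riesz n α) μ y ≤ ∫⁻ z, ENNReal.ofReal (T ^ (α - n)) ∂μ := by
            have hR' : ∀ᵐ z ∂μ, z ∈ Metric.closedBall (0 : Rn n) R := by
              rw [ae_iff]; exact hR
            refine lintegral_mono_ae (hR'.mono fun z hz => riesz_le_of_le hαn hT0 ?_)
            have hz : ‖z‖ ≤ R := by simpa using hz
            have := norm_sub_norm_le y z
            linarith
        _ = _ := by simp
    · rw [hpot]
      exact (mul_le_mul' le_rfl hy).trans_eq (mul_one c)
  rw [hpot] at key
  exact (ENNReal.mul_le_mul_iff_right hc0 hct).1 (key.trans_eq (mul_one c).symm)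

lemma innerCap_mono {X : Type*} [TopologicalSpace X] [MeasurableSpace X] (κ : X → X → ℝ≥0∞)
    {P Q : Set X} (h : P ⊆ Q) : innerCap κ P ≤ innerCap κ Q :=
  iSup₂_le fun K hK => iSup_le fun hKP =>
    le_iSup_of_le K (le_iSup_of_le hK (le_iSup_of_le (hKP.trans h) le_rfl))

lemma innerCap_empty {X : Type*} [TopologicalSpace X] [MeasurableSpace X] (κ : X → X → ℝ≥0∞) :
    innerCap κ (∅ : Set X) = 0 := by
  refine le_antisymm (iSup₂_le fun K _ => iSup_le fun hK => ?_) zero_le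
  rw [subset_empty_iff.1 hK, capC, nonpos_iff_eq_zero, ENNReal.inv_eq_zero]
  refine iInf_eq_top.2 fun μ => iInf_eq_top.2 fun hμ => iInf_eq_top.2 fun h => ?_
  simp at h

lemma energy_mono {X : Type*} [TopologicalSpace X] [MeasurableSpace X] (κ : X → X → ℝ≥0∞)
    {μ μ' ν ν' : Measure X} (h : μ ≤ μ') (h' : ν ≤ ν') : energy κ μ ν ≤ energy κ μ' ν' :=
  lintegral_mono' h fun _ => lintegral_mono' h' le_rfl

lemma potential_smul {X : Type*} [TopologicalSpace X] [MeasurableSpace X] (κ : X → X → ℝ≥0∞)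
    (c : ℝ≥0∞) (μ : Measure X) (x : X) : potential κ (c • μ) x = c * potential κ μ x := by
  simp [potential]

lemma potential_add {X : Type*} [TopologicalSpace X] [MeasurableSpace X] (κ : X → X → ℝ≥0∞)
    (μ ν : Measure X) (x : X) : potential κ (μ + ν) x = potential κ μ x + potential κ ν x :=
  lintegral_add_measure _ _ _

/-- A finite measure of finite energy does not charge sets of inner capacity zero. -/
lemma measure_eq_zero_of_innerCap_eq_zero {κ : Rn n → Rn n → ℝ≥0∞} {μ : Measure (Rn n)}
    [IsFiniteMeasure μ] (hμ : energy κ μ μ ≠ ⊤) {N : Set (Rn n)} (hN : MeasurableSet N)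
    (h0 : innerCap κ N = 0) : μ N = 0 := by
  by_contra hne
  obtain ⟨K, hKN, hK, hK0⟩ := hN.exists_lt_isCompact (pos_iff_ne_zero.2 hne)
  have hKt : μ K ≠ ⊤ := measure_ne_top μ K
  have hcap : capC κ K = 0 := by
    refine le_antisymm (le_trans ?_ h0.le) zero_le
    exact le_iSup_of_le K (le_iSup_of_le hK (le_iSup_of_le hKN le_rfl))
  rw [capC, ENNReal.inv_eq_zero] at hcap
  set p : Measure (Rn n) := (μ K)⁻¹ • μ.restrict K with hp
  have hp1 : IsProbabilityMeasure p := ⟨by simp [hp, ENNReal.inv_mul_cancel hK0.ne' hKt]⟩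
  have hpK : p Kᶜ = 0 := by simp [hp, hK.measurableSet]
  have h1 := iInf_eq_top.1 (iInf_eq_top.1 (iInf_eq_top.1 hcap p) hp1) hpK
  have h2 : energy κ p p = (μ K)⁻¹ * ((μ K)⁻¹ * energy κ (μ.restrict K) (μ.restrict K)) := by
    unfold energy
    rw [hp, lintegral_smul_measure]
    simp_rw [potential_smul]
    rw [lintegral_const_mul' _ _ (ENNReal.inv_ne_top.2 hK0.ne')]
    rfl
  have h3 : energy κ (μ.restrict K) (μ.restrict K) ≠ ⊤ :=
    ne_top_of_le_ne_top hμ (energy_mono κ Measure.restrict_le_self Measure.restrict_le_self)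
  rw [h2] at h1
  have hi := ENNReal.inv_ne_top.2 hK0.ne'
  exact ENNReal.mul_ne_top hi (ENNReal.mul_ne_top hi h3) h1

lemma le_potential_of_subset_closedBall {α : ℝ} (hαn : α < n) {R : ℝ} {μ : Measure (Rn n)}
    (hμ : μ (Metric.closedBall 0 R)ᶜ = 0) {x : Rn n} (hx : ‖x‖ ≤ R) :
    ENNReal.ofReal ((2 * R) ^ (α - n)) * μ univ ≤ potential (riesz n α) μ x := by
  rw [← lintegral_const]
  have hR' : ∀ᵐ z ∂μ, z ∈ Metric.closedBall (0 : Rn n) R := by rw [ae_iff]; exact hμ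
  refine lintegral_mono_ae (hR'.mono fun z hz => le_riesz_of_le hαn ?_)
  have hz : ‖z‖ ≤ R := by simpa using hz
  have := norm_sub_le x z
  linarith

lemma innerCap_lt_top {α : ℝ} (hαn : α < n) {R : ℝ} (hR : 0 < R) {Q : Set (Rn n)}
    (hQ : Q ⊆ Metric.closedBall 0 R) : innerCap (riesz n α) Q < ⊤ := by
  have hpos : 0 < ENNReal.ofReal ((2 * R) ^ (α - n)) := by
    rw [ENNReal.ofReal_pos]; positivity
  refine lt_of_le_of_lt (iSup₂_le fun K hK => iSup_le fun hKQ => ?_)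
    (ENNReal.inv_lt_top.2 hpos)
  rw [capC, ENNReal.inv_le_inv]
  refine le_iInf fun μ => le_iInf fun hμ => le_iInf fun hμK => ?_
  have hμR : μ (Metric.closedBall 0 R)ᶜ = 0 :=
    measure_mono_null (compl_subset_compl.2 (hKQ.trans hQ)) hμK
  calc ENNReal.ofReal ((2 * R) ^ (α - n)) = ∫⁻ x, ENNReal.ofReal ((2 * R) ^ (α - n)) ∂μ := by simp
    _ ≤ energy (riesz n α) μ μ := by
      have hR' : ∀ᵐ z ∂μ, z ∈ Metric.closedBall (0 : Rn n) R := by rw [ae_iff]; exact hμR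
      refine lintegral_mono_ae (hR'.mono fun z hz => ?_)
      simpa using le_potential_of_subset_closedBall hαn hμR (x := z) (by simpa using hz)

/-- Every bounded set carries a measure with potential at most one everywhere, whose mass is
comparable to the inner capacity of the set. -/
lemma exists_measure_potential_le_one {α : ℝ} (hα0 : 0 < α) (hα2 : α ≤ 2) (hαn : α < n) {R : ℝ}
    (hR : 0 < R) {Q : Set (Rn n)} (hQ : Q ⊆ Metric.closedBall 0 R) :
    ∃ γ : Measure (Rn n), IsFiniteMeasure γ ∧ γ Qᶜ = 0 ∧ (∀ x, potential (riesz n α) γ x ≤ 1) ∧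
      innerCap (riesz n α) Q ≤ 8 * γ univ := by
  by_cases h0 : innerCap (riesz n α) Q = 0
  · exact ⟨0, inferInstance, by simp, by simp [potential], by simp [h0]⟩
  have hlt : innerCap (riesz n α) Q / 2 < innerCap (riesz n α) Q :=
    ENNReal.half_lt_self h0 (innerCap_lt_top hαn hR hQ).ne
  set c := innerCap (riesz n α) Q / 2 with hc
  have hc0 : c ≠ 0 := (ENNReal.div_pos h0 (by simp)).ne'
  have hct : c ≠ ⊤ := hlt.ne_top
  unfold innerCap at hlt
  simp only [lt_iSup_iff] at hlt
  obtain ⟨K, hK, hKQ, hlt⟩ := hlt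
  rw [capC, ENNReal.lt_inv_iff_lt_inv] at hlt
  simp only [iInf_lt_iff] at hlt
  obtain ⟨p, hp, hpK, hE⟩ := hlt
  set t := 2 * c⁻¹ with ht
  have hci : c⁻¹ ≠ ⊤ := ENNReal.inv_ne_top.2 hc0
  have hci0 : c⁻¹ ≠ 0 := ENNReal.inv_ne_zero.2 hct
  have ht0 : t ≠ 0 := mul_ne_zero two_ne_zero hci0
  have htt : t ≠ ⊤ := ENNReal.mul_ne_top ofNat_ne_top hci
  set G := {x | potential (riesz n α) p x ≤ t} with hG
  have hGm : MeasurableSet G := measurableSet_le (by fun_prop) measurable_const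
  have hmarkov : p Gᶜ ≤ 2⁻¹ := by
    have h1 : t * p {x | t ≤ potential (riesz n α) p x} ≤ c⁻¹ :=
      (mul_meas_ge_le_lintegral (measurable_potential α p) t).trans hE.le
    have h2 : p Gᶜ ≤ p {x | t ≤ potential (riesz n α) p x} :=
      measure_mono fun x hx => (not_le.1 (show ¬ potential (riesz n α) p x ≤ t from hx)).le
    have h3 : c⁻¹ * (2 * p Gᶜ) ≤ c⁻¹ * 1 := by
      rw [mul_one, ← mul_assoc, mul_comm c⁻¹]
      exact (mul_le_mul' le_rfl h2).trans h1
    have h4 := (ENNReal.mul_le_mul_iff_right hci0 hci).1 h3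
    rw [← one_div, ENNReal.le_div_iff_mul_le (by simp) (by simp), mul_comm]
    exact h4
  have hpG : 2⁻¹ ≤ p G := by
    have h1 := prob_add_prob_compl (μ := p) hGm
    have h2 : (1 : ℝ≥0∞) ≤ p G + 2⁻¹ := by rw [← h1]; gcongr
    rw [← ENNReal.inv_two_add_inv_two] at h2
    exact (ENNReal.add_le_add_iff_right (by simp)).1 h2
  have hti : t⁻¹ ≠ ⊤ := ENNReal.inv_ne_top.2 ht0
  have hfin : IsFiniteMeasure (t⁻¹ • p.restrict G) :=
    ⟨by simpa using ENNReal.mul_lt_top hti.lt_top (measure_lt_top p G)⟩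
  have hnull : (t⁻¹ • p.restrict G) Qᶜ = 0 := by
    have h1 : p.restrict G Kᶜ = 0 := le_antisymm ((Measure.restrict_le_self _).trans hpK.le) zero_le
    have h2 : p.restrict G Qᶜ = 0 := measure_mono_null (compl_subset_compl.2 hKQ) h1
    simp [h2]
  refine ⟨t⁻¹ • p.restrict G, hfin, hnull, ?_, ?_⟩
  · refine potential_le_one_of_ae hα0 hα2 hαn _ (R := R)
      (measure_mono_null (compl_subset_compl.2 hQ) hnull) ?_
    refine Measure.ae_smul_measure ?_ _
    filter_upwards [ae_restrict_mem hGm] with x hx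
    rw [potential_smul]
    calc t⁻¹ * potential (riesz n α) (p.restrict G) x ≤ t⁻¹ * t := by
          gcongr
          exact (lintegral_mono' Measure.restrict_le_self le_rfl).trans hx
      _ ≤ 1 := ENNReal.inv_mul_le_one t
  · have h1 : innerCap (riesz n α) Q = 2 * c := by
      rw [hc, ENNReal.mul_div_cancel (by simp) (by simp)]
    have h2 : t⁻¹ = 2⁻¹ * c := by rw [ht, ENNReal.mul_inv (by simp) (by simp), inv_inv]
    rw [h1]
    simp only [Measure.smul_apply, Measure.restrict_apply_univ, smul_eq_mul]
    calc 2 * c = 2 * (2 * 2⁻¹) * (2 * 2⁻¹) * c := by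
          rw [ENNReal.mul_inv_cancel (by simp) (by simp)]; ring
      _ = 8 * (2⁻¹ * c * 2⁻¹) := by ring
      _ ≤ _ := by rw [h2]; gcongr

lemma riesz_le_mul_rpow_norm {α : ℝ} (hαn : α < n) {q : ℝ} (hq : 1 < q) {x y : Rn n}
    (hy : 0 < ‖y‖) (h : ‖x‖ ≤ ‖y‖ / q) :
    riesz n α x y ≤ ENNReal.ofReal ((1 - 1 / q) ^ (α - n)) * ENNReal.ofReal (‖y‖ ^ (α - n)) := by
  have h1 : 0 < 1 - 1 / q := by
    rw [sub_pos, div_lt_one (by linarith)]; exact hq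
  rw [← ENNReal.ofReal_mul (by positivity), ← Real.mul_rpow h1.le hy.le]
  refine riesz_le_of_le hαn (by positivity) ?_
  have h2 := norm_sub_norm_le y x
  rw [norm_sub_rev] at h2
  calc (1 - 1 / q) * ‖y‖ = ‖y‖ - ‖y‖ / q := by ring
    _ ≤ _ := by linarith

lemma mul_rpow_norm_le_riesz {α : ℝ} (hαn : α < n) {q : ℝ} (hq : 1 < q) {x y : Rn n}
    (h : ‖x‖ ≤ ‖y‖ / q) :
    ENNReal.ofReal ((1 + 1 / q) ^ (α - n)) * ENNReal.ofReal (‖y‖ ^ (α - n)) ≤ riesz n α x y := by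
  have h1 : 0 < 1 + 1 / q := by positivity
  rw [← ENNReal.ofReal_mul (by positivity), ← Real.mul_rpow h1.le (norm_nonneg y)]
  refine le_riesz_of_le hαn ?_
  have h2 := norm_sub_le x y
  calc _ ≤ ‖y‖ / q + ‖y‖ := by linarith
    _ = _ := by ring

/-- The shell `q ^ j ≤ |x| < q ^ (j + 1)`. -/
def shell (n : ℕ) (q : ℝ) (j : ℕ) : Set (Rn n) := {x | q ^ j ≤ ‖x‖ ∧ ‖x‖ < q ^ (j + 1)}

lemma shell_subset_closedBall (q : ℝ) (j : ℕ) :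
    shell n q j ⊆ Metric.closedBall 0 (q ^ (j + 1)) := fun x hx => by
  simpa using hx.2.le

/-- The integral of the Riesz kernel with pole at the origin. -/
noncomputable def moment (α : ℝ) (γ : Measure (Rn n)) : ℝ≥0∞ :=
  ∫⁻ y, ENNReal.ofReal (‖y‖ ^ (α - n)) ∂γ

/-- Non-thinness at infinity yields measures on the shells with potentials at most one whose
moments have divergent sum. -/
lemma exists_shell_measures {α : ℝ} (hα0 : 0 < α) (hα2 : α ≤ 2) (hαn : α < n)
    {A : Set (Rn n)} (hA : ¬ InnerThinAtInfinity n α A) {q : ℝ} (hq : 1 < q) :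
    ∃ γ : ℕ → Measure (Rn n), (∀ j, IsFiniteMeasure (γ j)) ∧ (∀ j, γ j (A ∩ shell n q j)ᶜ = 0) ∧
      (∀ j x, potential (riesz n α) (γ j) x ≤ 1) ∧ ∑' j, moment α (γ j) = ⊤ ∧
      ∀ j, moment α (γ j) ≠ ⊤ := by
  have hq0 : 0 < q := by linarith
  choose γ hfin hnull hpot hcap using fun j : ℕ =>
    exists_measure_potential_le_one hα0 hα2 hαn (R := q ^ (j + 1)) (by positivity)
      (Q := A ∩ shell n q j) (inter_subset_right.trans (shell_subset_closedBall q j))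
  have hmem : ∀ j, ∀ᵐ y ∂γ j, y ∈ shell n q j := fun j => by
    rw [ae_iff]
    exact measure_mono_null (t := (A ∩ shell n q j)ᶜ) (fun y hy h => hy h.2) (hnull j)
  refine ⟨γ, hfin, hnull, hpot, ?_, fun j => ?_⟩
  · set c : ℝ≥0∞ := ENNReal.ofReal (q ^ (n - α)) with hc
    have hsum : ∑' j : ℕ, innerCap (riesz n α) (A ∩ shell n q j) /
        ENNReal.ofReal (q ^ ((j : ℝ) * ((n : ℝ) - α))) = ⊤ := by
      by_contra h
      exact hA ⟨q, hq, lt_top_iff_ne_top.2 h⟩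
    have hle : ∀ j : ℕ, innerCap (riesz n α) (A ∩ shell n q j) /
        ENNReal.ofReal (q ^ ((j : ℝ) * ((n : ℝ) - α))) ≤ 8 * c * moment α (γ j) := by
      intro j
      have hm : ENNReal.ofReal ((q ^ (j + 1)) ^ (α - n)) * γ j univ ≤ moment α (γ j) := by
        rw [← lintegral_const]
        refine lintegral_mono_ae ((hmem j).mono fun y hy => ENNReal.ofReal_le_ofReal ?_)
        have : 0 < q ^ j := by positivity
        exact Real.rpow_le_rpow_of_nonpos (this.trans_le hy.1) hy.2.le (by linarith)
      have hfac : (ENNReal.ofReal (q ^ ((j : ℝ) * ((n : ℝ) - α))))⁻¹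
          = c * ENNReal.ofReal ((q ^ (j + 1)) ^ (α - n)) := by
        rw [← ENNReal.ofReal_inv_of_pos (by positivity), hc, ← ENNReal.ofReal_mul (by positivity),
          ← Real.rpow_natCast, ← Real.rpow_mul hq0.le, ← Real.rpow_add hq0, ← Real.rpow_neg hq0.le]
        congr 2; push_cast; ring
      rw [div_eq_mul_inv, hfac]
      calc _ ≤ (8 * γ j univ) * (c * ENNReal.ofReal ((q ^ (j + 1)) ^ (α - n))) := by
            gcongr; exact hcap j
        _ = 8 * c * (ENNReal.ofReal ((q ^ (j + 1)) ^ (α - n)) * γ j univ) := by ring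
        _ ≤ _ := by gcongr
    have h1 := ENNReal.tsum_le_tsum hle
    rw [hsum, ENNReal.tsum_mul_left, top_le_iff] at h1
    by_contra h2
    exact ENNReal.mul_ne_top (ENNReal.mul_ne_top (by simp) ENNReal.ofReal_ne_top) h2 h1
  · refine ne_top_of_le_ne_top one_ne_top (le_trans (le_of_eq ?_) (hpot j 0))
    refine lintegral_congr_ae ((hmem j).mono fun y hy => ?_)
    have hy0 : (0 : Rn n) ≠ y := by
      rintro rfl
      have : 0 < q ^ j := by positivity
      have := hy.1
      simp at this
      linarith
    simp [riesz, hy0]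

lemma measure_univ_le_of_potential_le_one {α : ℝ} (hαn : α < n) {R : ℝ} (hR : 0 < R)
    {γ : Measure (Rn n)} (hγ : γ (Metric.closedBall 0 R)ᶜ = 0)
    (h : ∀ x, potential (riesz n α) γ x ≤ 1) : γ univ ≤ ENNReal.ofReal ((2 * R) ^ (n - α)) := by
  have h1 := (le_potential_of_subset_closedBall hαn hγ (x := 0) (by simpa using hR.le)).trans (h 0)
  have h2 : ENNReal.ofReal ((2 * R) ^ (n - α)) * ENNReal.ofReal ((2 * R) ^ (α - n)) = 1 := by
    rw [← ENNReal.ofReal_mul (by positivity), ← Real.rpow_add (by positivity)]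
    simp
  calc γ univ = ENNReal.ofReal ((2 * R) ^ (n - α)) *
        (ENNReal.ofReal ((2 * R) ^ (α - n)) * γ univ) := by rw [← mul_assoc, h2, one_mul]
    _ ≤ ENNReal.ofReal ((2 * R) ^ (n - α)) * 1 := by gcongr
    _ = _ := mul_one _

lemma sum_range_pow_le {r : ℝ} (hr : 2 ≤ r) (m : ℕ) : ∑ j ∈ Finset.range m, r ^ j ≤ r ^ m := by
  induction m with
  | zero => simp
  | succ k ih =>
    rw [Finset.sum_range_succ, pow_succ]
    nlinarith [pow_pos (show (0 : ℝ) < r by linarith) k]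

/-- Uniform bound on the potential of a sum of shell measures, at points of the shells. -/
lemma sum_potential_le {α : ℝ} (hαn : α < n) {q : ℝ} (hq : 2 ≤ q) (hqe : 2 ≤ q ^ (n - α))
    {γ : ℕ → Measure (Rn n)} (hmem : ∀ j, γ j (shell n q j)ᶜ = 0)
    (hpot : ∀ j x, potential (riesz n α) (γ j) x ≤ 1) (J i : ℕ) {x : Rn n}
    (hx : x ∈ shell n q i) :
    ∑ j ∈ Finset.range J, potential (riesz n α) (γ j) x ≤
      3 + ENNReal.ofReal (4 ^ (n - α)) +
        ENNReal.ofReal ((1 - 1 / q) ^ (α - n)) * ∑ j ∈ Finset.range J, moment α (γ j) := by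
  have hq0 : 0 < q := by linarith
  have hq1 : 1 < q := by linarith
  have hmem' : ∀ j, ∀ᵐ y ∂γ j, y ∈ shell n q j := fun j => by rw [ae_iff]; exact hmem j
  set ρ := q ^ (n - α) with hρ
  have hρ0 : 0 < ρ := by linarith
  set a := ENNReal.ofReal ((1 - 1 / q) ^ (α - n)) with ha
  have hfar : ∀ j, i + 2 ≤ j → potential (riesz n α) (γ j) x ≤ a * moment α (γ j) := by
    intro j hj
    rw [moment, ← lintegral_const_mul' _ _ ENNReal.ofReal_ne_top]
    refine lintegral_mono_ae ((hmem' j).mono fun y hy => ?_)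
    have hqj : 0 < q ^ j := by positivity
    refine riesz_le_mul_rpow_norm hαn hq1 (hqj.trans_le hy.1) ?_
    rw [le_div_iff₀ hq0]
    calc ‖x‖ * q ≤ q ^ (i + 1) * q := by gcongr; exact hx.2.le
      _ = q ^ (i + 2) := by ring
      _ ≤ q ^ j := pow_le_pow_right₀ hq1.le hj
      _ ≤ ‖y‖ := hy.1
  have hnear : ∀ j, j + 2 ≤ i →
      potential (riesz n α) (γ j) x ≤ ENNReal.ofReal (4 ^ (n - α) * (ρ ^ (j + 1) / ρ ^ i)) := by
    intro j hj
    have hqi : 0 < q ^ i := by positivity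
    have h1 : potential (riesz n α) (γ j) x ≤
        ENNReal.ofReal ((q ^ i / 2) ^ (α - n)) * γ j univ := by
      rw [← lintegral_const]
      refine lintegral_mono_ae ((hmem' j).mono fun y hy => riesz_le_of_le hαn (by positivity) ?_)
      have h2 : ‖y‖ ≤ q ^ i / 2 := by
        rw [le_div_iff₀ two_pos]
        calc ‖y‖ * 2 ≤ q ^ (j + 1) * q := by gcongr; exact hy.2.le
          _ = q ^ (j + 2) := by ring
          _ ≤ q ^ i := pow_le_pow_right₀ hq1.le hj
      have h3 := norm_sub_norm_le x y
      linarith [hx.1]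
    have h2 := measure_univ_le_of_potential_le_one hαn (R := q ^ (j + 1)) (by positivity)
      (measure_mono_null (compl_subset_compl.2 (shell_subset_closedBall q j)) (hmem j)) (hpot j)
    refine (h1.trans (mul_le_mul' le_rfl h2)).trans (le_of_eq ?_)
    rw [← ENNReal.ofReal_mul (by positivity)]
    congr 1
    have e1 : ∀ k : ℕ, (q ^ k) ^ (n - α) = ρ ^ k := fun k => by
      rw [hρ, ← Real.rpow_natCast, ← Real.rpow_natCast, ← Real.rpow_mul hq0.le,
        ← Real.rpow_mul hq0.le, mul_comm]
    have e2 : (q ^ i / 2) ^ (α - n) = 2 ^ (n - α) / ρ ^ i := by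
      rw [← neg_sub (n : ℝ) α, Real.rpow_neg (by positivity),
        Real.div_rpow (by positivity) (by positivity), e1, inv_div]
    rw [e2, Real.mul_rpow (by positivity) (by positivity), e1]
    have e3 : (4 : ℝ) ^ (n - α) = 2 ^ (n - α) * 2 ^ (n - α) := by
      rw [← Real.mul_rpow (by positivity) (by positivity)]; norm_num
    rw [e3]; ring
  have hterm : ∀ j, potential (riesz n α) (γ j) x ≤
      ((if j + 1 = i ∨ j = i ∨ j = i + 1 then 1 else 0) +
        (if j ∈ Finset.range (i - 1) then
          ENNReal.ofReal (4 ^ (n - α) * (ρ ^ (j + 1) / ρ ^ i)) else 0)) + a * moment α (γ j) := by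
    intro j
    by_cases h1 : j + 1 = i ∨ j = i ∨ j = i + 1
    · rw [if_pos h1, add_assoc]; exact (hpot j x).trans le_self_add
    · by_cases h2 : i + 2 ≤ j
      · exact (hfar j h2).trans le_add_self
      · have h3 : j + 2 ≤ i := by omega
        rw [if_neg h1, if_pos (Finset.mem_range.2 (by omega)), zero_add]
        exact (hnear j h3).trans le_self_add
  refine (Finset.sum_le_sum fun j _ => hterm j).trans ?_
  rw [Finset.sum_add_distrib, Finset.sum_add_distrib, ← Finset.mul_sum]
  gcongr
  · rw [← Finset.sum_filter]
    simp only [Finset.sum_const, nsmul_eq_mul, mul_one]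
    have : (Finset.filter (fun j => j + 1 = i ∨ j = i ∨ j = i + 1) (Finset.range J)).card ≤ 3 := by
      refine (Finset.card_le_card (t := {i - 1, i, i + 1}) fun j hj => ?_).trans
        Finset.card_le_three
      simp only [Finset.mem_filter, Finset.mem_insert, Finset.mem_singleton] at hj ⊢
      omega
    exact_mod_cast this
  · calc _ ≤ ∑ j ∈ Finset.range (i - 1),
          ENNReal.ofReal (4 ^ (n - α) * (ρ ^ (j + 1) / ρ ^ i)) := by
          rw [← Finset.sum_filter]
          refine Finset.sum_le_sum_of_subset fun j hj => (Finset.mem_filter.1 hj).2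
      _ = ENNReal.ofReal (4 ^ (n - α) * ((ρ * ∑ j ∈ Finset.range (i - 1), ρ ^ j) / ρ ^ i)) := by
          rw [← ENNReal.ofReal_sum_of_nonneg fun j _ => by positivity, ← Finset.mul_sum,
            ← Finset.sum_div, Finset.mul_sum]
          simp_rw [pow_succ']
      _ ≤ _ := by
          refine ENNReal.ofReal_le_ofReal (mul_le_of_le_one_right (by positivity) ?_)
          rw [div_le_one (by positivity)]
          rcases Nat.eq_zero_or_pos i with rfl | hi
          · simp
          · calc ρ * ∑ j ∈ Finset.range (i - 1), ρ ^ j ≤ ρ * ρ ^ (i - 1) := by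
                  gcongr; exact sum_range_pow_le hqe _
              _ = ρ ^ i := by rw [← pow_succ', Nat.sub_add_cancel hi]

lemma potential_finset_sum {X ι : Type*} [TopologicalSpace X] [MeasurableSpace X]
    (κ : X → X → ℝ≥0∞) (s : Finset ι) (μ : ι → Measure X) (x : X) :
    potential κ (∑ i ∈ s, μ i) x = ∑ i ∈ s, potential κ (μ i) x :=
  lintegral_finsetSum_measure _ _ _

/-- Finite-stage mass comparison. -/
lemma mass_comparison_step {α : ℝ} (hα0 : 0 < α) (hα2 : α ≤ 2) (hαn : α < n) {A : Set (Rn n)}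
    (hA : MeasurableSet A) {q : ℝ} (hq : 2 ≤ q) (hqe : 2 ≤ q ^ (n - α))
    {γ : ℕ → Measure (Rn n)} (hfin : ∀ j, IsFiniteMeasure (γ j))
    (hmem : ∀ j, γ j (A ∩ shell n q j)ᶜ = 0)
    (hpot : ∀ j x, potential (riesz n α) (γ j) x ≤ 1) (hmom : ∀ j, moment α (γ j) ≠ ⊤)
    {ω ν : Measure (Rn n)} [SFinite ω] [SFinite ν]
    (hN : innerCap (riesz n α)
      {x ∈ A | ¬ potential (riesz n α) ω x ≤ potential (riesz n α) ν x} = 0)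
    {R : ℝ} {j₀ : ℕ} (hj₀ : q * R ≤ q ^ j₀) (J : ℕ) :
    ENNReal.ofReal ((1 + 1 / q) ^ (α - n)) * (∑ j ∈ Finset.range J, moment α (γ j)) *
        ω (Metric.closedBall 0 R) ≤
      (3 + ENNReal.ofReal (4 ^ (n - α)) +
        ENNReal.ofReal ((1 - 1 / q) ^ (α - n)) * ∑ j ∈ Finset.range J, moment α (γ j)) * ν univ +
      ENNReal.ofReal ((1 + 1 / q) ^ (α - n)) * (∑ j ∈ Finset.range j₀, moment α (γ j)) *
        ω (Metric.closedBall 0 R) := by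
  have hq0 : 0 < q := by linarith
  have hq1 : 1 < q := by linarith
  have hshell : ∀ j, γ j (shell n q j)ᶜ = 0 := fun j =>
    measure_mono_null (compl_subset_compl.2 inter_subset_right) (hmem j)
  have hAnull : ∀ j, γ j Aᶜ = 0 := fun j =>
    measure_mono_null (compl_subset_compl.2 inter_subset_left) (hmem j)
  set S := ∑ j ∈ Finset.range J, moment α (γ j) with hS
  have hSt : S ≠ ⊤ := by
    rw [hS]; exact ENNReal.sum_ne_top.2 fun j _ => hmom j
  set b := ENNReal.ofReal ((1 + 1 / q) ^ (α - n)) with hb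
  set M := 3 + ENNReal.ofReal (4 ^ (n - α)) + ENNReal.ofReal ((1 - 1 / q) ^ (α - n)) * S with hM
  have hM0 : M ≠ 0 := by simp [hM]
  have hMt : M ≠ ⊤ := by
    simp only [hM]
    exact ENNReal.add_ne_top.2 ⟨ENNReal.add_ne_top.2 ⟨by simp, ENNReal.ofReal_ne_top⟩,
      ENNReal.mul_ne_top ENNReal.ofReal_ne_top hSt⟩
  set μ := ∑ j ∈ Finset.range J, γ j with hμ
  have hμnull : ∀ {T : Set (Rn n)}, (∀ j < J, γ j T = 0) → μ T = 0 := fun {T} hT => by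
    rw [hμ, Measure.finsetSum_apply]
    exact Finset.sum_eq_zero fun j hj => hT j (Finset.mem_range.1 hj)
  have hμfin : IsFiniteMeasure μ := by
    rw [hμ]; infer_instance
  have hμae : ∀ᵐ x ∂μ, ∃ i, x ∈ shell n q i := by
    rw [ae_iff]
    exact hμnull fun j _ => measure_mono_null (fun x hx h => hx ⟨j, h⟩) (hshell j)
  have hμM : ∀ x, potential (riesz n α) μ x ≤ M := by
    intro x
    have hfin' : IsFiniteMeasure (M⁻¹ • μ) :=
      ⟨by simpa using ENNReal.mul_lt_top (ENNReal.inv_ne_top.2 hM0).lt_top (measure_lt_top μ univ)⟩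
    have h1 : potential (riesz n α) (M⁻¹ • μ) x ≤ 1 := by
      refine potential_le_one_of_ae hα0 hα2 hαn _ (R := q ^ J) ?_ ?_ x
      · rw [Measure.smul_apply, hμnull (fun j hj => ?_), smul_zero]
        refine measure_mono_null (compl_subset_compl.2 ((shell_subset_closedBall q j).trans
          (Metric.closedBall_subset_closedBall ?_))) (hshell j)
        exact pow_le_pow_right₀ hq1.le hj
      · refine Measure.ae_smul_measure (hμae.mono fun y ⟨i, hi⟩ => ?_) _
        rw [potential_smul, hμ, potential_finset_sum]
        refine (mul_le_mul' le_rfl (sum_potential_le hαn hq hqe hshell hpot J i hi)).trans ?_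
        exact ENNReal.inv_mul_le_one M
    rw [potential_smul] at h1
    calc _ = M * (M⁻¹ * potential (riesz n α) μ x) := by
          rw [← mul_assoc, ENNReal.mul_inv_cancel hM0 hMt, one_mul]
      _ ≤ M * 1 := by gcongr
      _ = M := mul_one M
  have hEμ : energy (riesz n α) μ μ ≠ ⊤ := by
    refine ne_top_of_le_ne_top (ENNReal.mul_ne_top hMt (measure_ne_top μ univ)) ?_
    rw [← lintegral_const]
    exact lintegral_mono hμM
  have hle : ∀ᵐ x ∂μ, potential (riesz n α) ω x ≤ potential (riesz n α) ν x := by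
    have hNm : MeasurableSet {x ∈ A | ¬ potential (riesz n α) ω x ≤ potential (riesz n α) ν x} :=
      hA.inter (measurableSet_le (measurable_potential α ω) (measurable_potential α ν)).compl
    have h1 := measure_eq_zero_of_innerCap_eq_zero hEμ hNm hN
    have h2 : μ Aᶜ = 0 := hμnull fun j _ => hAnull j
    rw [ae_iff]
    refine measure_mono_null (fun x hx => ?_) (measure_union_null h1 h2)
    by_cases hxA : x ∈ A
    · exact Or.inl ⟨hxA, hx⟩
    · exact Or.inr hxA
  have hchain : ∫⁻ x, potential (riesz n α) μ x ∂ω ≤ M * ν univ := by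
    calc ∫⁻ x, potential (riesz n α) μ x ∂ω = energy (riesz n α) μ ω := energy_comm α ω μ
      _ ≤ energy (riesz n α) μ ν := lintegral_mono_ae hle
      _ = energy (riesz n α) ν μ := energy_comm α μ ν
      _ ≤ ∫⁻ _, M ∂ν := lintegral_mono hμM
      _ = _ := by simp
  have hpt : ∀ x ∈ Metric.closedBall (0 : Rn n) R, b * S ≤
      potential (riesz n α) μ x + b * ∑ j ∈ Finset.range j₀, moment α (γ j) := by
    intro x hx
    have hx : ‖x‖ ≤ R := by simpa using hx
    have hj : ∀ j, b * moment α (γ j) ≤ potential (riesz n α) (γ j) x +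
        if j ∈ Finset.range j₀ then b * moment α (γ j) else 0 := by
      intro j
      by_cases h : j < j₀
      · rw [if_pos (Finset.mem_range.2 h)]; exact le_add_self
      · rw [if_neg (by simpa using h), add_zero, moment,
          ← lintegral_const_mul' _ _ ENNReal.ofReal_ne_top]
        have h1 : ∀ᵐ y ∂γ j, y ∈ shell n q j := by rw [ae_iff]; exact hshell j
        refine lintegral_mono_ae (h1.mono fun y hy => mul_rpow_norm_le_riesz hαn hq1 ?_)
        rw [le_div_iff₀ hq0]
        calc ‖x‖ * q ≤ R * q := by gcongr
          _ ≤ q ^ j₀ := by linarith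
          _ ≤ q ^ j := pow_le_pow_right₀ hq1.le (not_lt.1 h)
          _ ≤ ‖y‖ := hy.1
    rw [hS, Finset.mul_sum, hμ, potential_finset_sum, Finset.mul_sum]
    refine (Finset.sum_le_sum fun j _ => hj j).trans ?_
    rw [Finset.sum_add_distrib]
    gcongr
    rw [← Finset.sum_filter]
    exact Finset.sum_le_sum_of_subset fun j hj => (Finset.mem_filter.1 hj).2
  calc b * S * ω (Metric.closedBall 0 R) = ∫⁻ x in Metric.closedBall 0 R, b * S ∂ω := by simp
    _ ≤ ∫⁻ x in Metric.closedBall 0 R, (potential (riesz n α) μ x +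
        b * ∑ j ∈ Finset.range j₀, moment α (γ j)) ∂ω :=
      setLIntegral_mono' Metric.isClosed_closedBall.measurableSet hpt
    _ = (∫⁻ x in Metric.closedBall 0 R, potential (riesz n α) μ x ∂ω) +
        b * (∑ j ∈ Finset.range j₀, moment α (γ j)) * ω (Metric.closedBall 0 R) := by
      rw [lintegral_add_right _ measurable_const]; simp
    _ ≤ _ := by
      gcongr
      exact (setLIntegral_le_lintegral _ _).trans hchain

lemma mul_le_mul_of_unbounded {b w a N c₀ c₁ : ℝ≥0∞} {S : ℕ → ℝ≥0∞} (hS : Tendsto S atTop (𝓝 ⊤))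
    (hSt : ∀ J, S J ≠ ⊤) (hN : N ≠ ⊤) (hc₀ : c₀ ≠ ⊤) (hc₁ : c₁ ≠ ⊤)
    (h : ∀ J, b * S J * w ≤ (c₀ + a * S J) * N + c₁) : b * w ≤ a * N := by
  have hinv : Tendsto (fun J => (S J)⁻¹ * (c₀ * N + c₁) + a * N) atTop
      (𝓝 (0 * (c₀ * N + c₁) + a * N)) := by
    refine Tendsto.add_const _ ?_
    refine ENNReal.Tendsto.mul_const ?_
      (Or.inr (ENNReal.add_ne_top.2 ⟨ENNReal.mul_ne_top hc₀ hN, hc₁⟩))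
    simpa using (tendsto_inv_iff.2 hS)
  rw [zero_mul, zero_add] at hinv
  refine ge_of_tendsto hinv ?_
  filter_upwards [hS.eventually_const_lt (show (0 : ℝ≥0∞) < ⊤ by simp)] with J hJ
  have h1 : (S J)⁻¹ * S J = 1 := ENNReal.inv_mul_cancel hJ.ne' (hSt J)
  calc b * w = (S J)⁻¹ * (b * S J * w) := by
        rw [show (S J)⁻¹ * (b * S J * w) = ((S J)⁻¹ * S J) * (b * w) by ring, h1, one_mul]
    _ ≤ (S J)⁻¹ * ((c₀ + a * S J) * N + c₁) := by gcongr; exact h J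
    _ = (S J)⁻¹ * (c₀ * N + c₁) + ((S J)⁻¹ * S J) * (a * N) := by ring
    _ = _ := by rw [h1, one_mul]

/-- Mass comparison: on a set that is not inner thin at infinity, domination of potentials
nearly everywhere implies domination of total masses. -/
theorem mass_le_of_potential_le {α : ℝ} (hα0 : 0 < α) (hα2 : α ≤ 2) (hαn : α < n) {A : Set (Rn n)}
    (hA : MeasurableSet A) (hthin : ¬ InnerThinAtInfinity n α A)
    {ω ν : Measure (Rn n)} [IsLocallyFiniteMeasure ω] [SFinite ν]
    (hN : innerCap (riesz n α)
      {x ∈ A | ¬ potential (riesz n α) ω x ≤ potential (riesz n α) ν x} = 0) :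
    ω univ ≤ ν univ := by
  by_cases hν : ν univ = ⊤
  · simp [hν]
  have hball : ∀ R : ℝ, ω (Metric.closedBall 0 R) ≤ ν univ := by
    intro R
    have hq : ∀ᶠ q : ℝ in atTop, ENNReal.ofReal ((1 + 1 / q) ^ (α - n)) * ω (Metric.closedBall 0 R)
        ≤ ENNReal.ofReal ((1 - 1 / q) ^ (α - n)) * ν univ := by
      filter_upwards [eventually_ge_atTop 2,
        (tendsto_rpow_atTop (y := n - α) (by linarith)).eventually_ge_atTop 2] with q hq hqe
      have hq1 : 1 < q := by linarith
      obtain ⟨γ, hfin, hmem, hpot, hsum, hmom⟩ := exists_shell_measures hα0 hα2 hαn hthin hq1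
      obtain ⟨j₀, hj₀⟩ := pow_unbounded_of_one_lt (q * R) hq1
      have hω : ω (Metric.closedBall 0 R) ≠ ⊤ := measure_closedBall_lt_top.ne
      have hlim := ENNReal.tendsto_nat_tsum fun j => moment α (γ j)
      rw [hsum] at hlim
      refine mul_le_mul_of_unbounded hlim (fun J => ENNReal.sum_ne_top.2 fun j _ => hmom j) hν
        (ENNReal.add_ne_top.2 ⟨by simp, ENNReal.ofReal_ne_top⟩)
        (ENNReal.mul_ne_top (ENNReal.mul_ne_top ENNReal.ofReal_ne_top
          (ENNReal.sum_ne_top.2 fun j _ => hmom j)) hω)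
        (mass_comparison_step hα0 hα2 hαn hA hq hqe hfin hmem hpot hmom hN hj₀.le)
    have hinv : Tendsto (fun q : ℝ => 1 / q) atTop (𝓝 0) := by
      simpa using tendsto_inv_atTop_zero (𝕜 := ℝ)
    have l1 : Tendsto (fun q : ℝ => ENNReal.ofReal ((1 + 1 / q) ^ (α - n)) *
        ω (Metric.closedBall 0 R)) atTop (𝓝 (1 * ω (Metric.closedBall 0 R))) := by
      refine ENNReal.Tendsto.mul_const ?_ (Or.inl one_ne_zero)
      have := (tendsto_const_nhds (x := (1 : ℝ))).add hinv
      simpa using ENNReal.tendsto_ofReal (this.rpow_const (p := α - n) (Or.inl (by norm_num)))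
    have l2 : Tendsto (fun q : ℝ => ENNReal.ofReal ((1 - 1 / q) ^ (α - n)) *
        ν univ) atTop (𝓝 (1 * ν univ)) := by
      refine ENNReal.Tendsto.mul_const ?_ (Or.inl one_ne_zero)
      have := (tendsto_const_nhds (x := (1 : ℝ))).sub hinv
      simpa using ENNReal.tendsto_ofReal (this.rpow_const (p := α - n) (Or.inl (by norm_num)))
    simpa using le_of_tendsto_of_tendsto l1 l2 hq
  have hU : (univ : Set (Rn n)) = ⋃ k : ℕ, Metric.closedBall 0 (k : ℝ) :=
    (Metric.iUnion_closedBall_nat 0).symm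
  rw [hU, Monotone.measure_iUnion fun i j hij =>
    Metric.closedBall_subset_closedBall (by exact_mod_cast hij), ← hU]
  exact iSup_le fun k => hball k

lemma lintegral_pot_eq_energy {α : ℝ} (hα : α < n) (μ ν : Measure (Rn n)) [SFinite ν] :
    ∫⁻ x, pot (α / 2) ν x ∂μ = ENNReal.ofReal (rieszConst n α) * energy (riesz n α) μ ν := by
  simp_rw [pot_eq_potential hα]
  exact lintegral_const_mul' _ _ ENNReal.ofReal_ne_top

lemma two_mul_lintegral_pot_le (β : ℝ) (μ ν : Measure (Rn n)) [SFinite μ] [SFinite ν] :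
    2 * ∫⁻ x, pot β ν x ∂μ ≤ ∫⁻ x, pot β μ x ∂μ + ∫⁻ x, pot β ν x ∂ν := by
  simp_rw [lintegral_pot]
  have hm : ∀ (μ ν : Measure (Rn n)) [SFinite μ] [SFinite ν],
      Measurable fun s => ∫⁻ x, smooth ν s x ∂μ := fun μ ν _ _ =>
    Measurable.lintegral_prod_right' (f := fun p : ℝ × Rn n => smooth ν p.1 p.2) (by fun_prop)
  have h1 := hm μ μ
  have h2 := hm μ ν
  rw [← lintegral_const_mul _ (by fun_prop), ← lintegral_add_left (by fun_prop)]
  refine lintegral_mono fun s => ?_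
  by_cases hs : 0 < s
  · have hs2 : 0 < s / 2 := by positivity
    have e : ∀ (μ ν : Measure (Rn n)) [SFinite μ] [SFinite ν],
        ∫⁻ x, smooth ν s x ∂μ = ∫⁻ z, smooth μ (s / 2) z * smooth ν (s / 2) z :=
      fun μ ν _ _ => by rw [lintegral_smooth_mul_smooth μ ν hs2 hs2, add_halves]
    rw [← mul_add, mul_left_comm, e μ μ, e μ ν, e ν ν]
    refine mul_le_mul' le_rfl ?_
    rw [← lintegral_const_mul _ (by fun_prop), ← lintegral_add_left (by fun_prop)]
    exact lintegral_mono fun z => two_mul_le_mul_self_add _ _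
  · simp [stab, hs]

lemma two_mul_energy_le {α : ℝ} (hα : α < n) (μ ν : Measure (Rn n)) [SFinite μ] [SFinite ν] :
    2 * energy (riesz n α) μ ν ≤ energy (riesz n α) μ μ + energy (riesz n α) ν ν := by
  have h := two_mul_lintegral_pot_le (α / 2) μ ν
  rw [lintegral_pot_eq_energy hα, lintegral_pot_eq_energy hα, lintegral_pot_eq_energy hα,
    mul_left_comm, ← mul_add] at h
  exact (ENNReal.mul_le_mul_iff_right (by simpa using rieszConst_pos hα) ENNReal.ofReal_ne_top).1 h

lemma energy_ne_top {α : ℝ} (hα : α < n) {μ ν : Measure (Rn n)} [SFinite μ] [SFinite ν]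
    (hμ : energy (riesz n α) μ μ ≠ ⊤) (hν : energy (riesz n α) ν ν ≠ ⊤) :
    energy (riesz n α) μ ν ≠ ⊤ := fun h => by
  have := two_mul_energy_le hα μ ν
  rw [h, ENNReal.mul_top two_ne_zero, top_le_iff] at this
  exact ENNReal.add_ne_top.2 ⟨hμ, hν⟩ this

lemma energy_add_left {X : Type*} [TopologicalSpace X] [MeasurableSpace X] (κ : X → X → ℝ≥0∞)
    (μ μ' ν : Measure X) : energy κ (μ + μ') ν = energy κ μ ν + energy κ μ' ν :=
  lintegral_add_measure _ _ _

lemma energy_smul_left {X : Type*} [TopologicalSpace X] [MeasurableSpace X] (κ : X → X → ℝ≥0∞)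
    (c : ℝ≥0∞) (μ ν : Measure X) : energy κ (c • μ) ν = c * energy κ μ ν := by
  simp [energy]

/-- The quadratic inequality behind the Cauchy–Schwarz inequality for the energy. -/
lemma energy_sub_le {α : ℝ} (hα : α < n) {σ μ ν : Measure (Rn n)}
    [SFinite σ] [SFinite μ] [SFinite ν]
    (hσ : energy (riesz n α) σ σ ≠ ⊤) (hμ : energy (riesz n α) μ μ ≠ ⊤)
    (hν : energy (riesz n α) ν ν ≠ ⊤) {t : ℝ} (ht : 0 ≤ t) :
    2 * t * ((energy (riesz n α) σ ν).toReal - (energy (riesz n α) σ μ).toReal) ≤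
      t ^ 2 * (energy (riesz n α) σ σ).toReal + ((energy (riesz n α) μ μ).toReal +
        (energy (riesz n α) ν ν).toReal - 2 * (energy (riesz n α) μ ν).toReal) := by
  have h := two_mul_energy_le hα (μ + ENNReal.ofReal t • σ) ν
  have hσμ := energy_ne_top hα hσ hμ
  have hσν := energy_ne_top hα hσ hν
  have hμν := energy_ne_top hα hμ hν
  have e : energy (riesz n α) (μ + ENNReal.ofReal t • σ) (μ + ENNReal.ofReal t • σ)
      = energy (riesz n α) μ μ + ENNReal.ofReal t * energy (riesz n α) σ μ +
        ENNReal.ofReal t *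
          (energy (riesz n α) σ μ + ENNReal.ofReal t * energy (riesz n α) σ σ) := by
    rw [energy_add_left, energy_smul_left, energy_comm α μ, energy_comm α σ, energy_add_left,
      energy_add_left, energy_smul_left, energy_smul_left, energy_comm α μ σ]
  rw [e, energy_add_left, energy_smul_left] at h
  have ht' : ENNReal.ofReal t ≠ ⊤ := ENNReal.ofReal_ne_top
  lift energy (riesz n α) σ σ to NNReal using hσ with sσ
  lift energy (riesz n α) μ μ to NNReal using hμ with sμ
  lift energy (riesz n α) ν ν to NNReal using hν with sν
  lift energy (riesz n α) σ μ to NNReal using hσμ with sσμ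
  lift energy (riesz n α) σ ν to NNReal using hσν with sσν
  lift energy (riesz n α) μ ν to NNReal using hμν with sμν
  lift t to NNReal using ht
  rw [ENNReal.ofReal_coe_nnreal] at h
  norm_cast at h
  have h' : (2 * (sμν + t * sσν) : ℝ) ≤ sμ + t * sσμ + t * (sσμ + t * sσ) + sν := by
    exact_mod_cast h
  simp only [ENNReal.coe_toReal]
  linarith

lemma sq_sDist {α : ℝ} (hα : α < n) {μ ν : Measure (Rn n)} [SFinite μ] [SFinite ν]
    (hμ : energy (riesz n α) μ μ ≠ ⊤) (hν : energy (riesz n α) ν ν ≠ ⊤) :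
    sDist (riesz n α) μ ν ^ 2 = (energy (riesz n α) μ μ).toReal +
        (energy (riesz n α) ν ν).toReal - 2 * (energy (riesz n α) μ ν).toReal := by
  refine Real.sq_sqrt ?_
  have := energy_sub_le hα hμ hμ hν (t := 0) le_rfl
  simpa using this

/-- Inequalities between potentials on `A` persist for pairings with the strong closure
of `E⁺(A)`. -/
lemma energy_le_of_memEClos {α : ℝ} (hα : α < n) {A : Set (Rn n)} {ω : Measure (Rn n)}
    (hω : memEClos (riesz n α) A ω) {σ τ : Measure (Rn n)} [SFinite σ] [SFinite τ]
    (hσ : energy (riesz n α) σ σ ≠ ⊤) (hτ : energy (riesz n α) τ τ ≠ ⊤)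
    (h : ∀ x ∈ A, potential (riesz n α) σ x ≤ potential (riesz n α) τ x) :
    energy (riesz n α) σ ω ≤ energy (riesz n α) τ ω := by
  obtain ⟨⟨hωR, hωE⟩, hcl⟩ := hω
  have hωR : ω.Regular := hωR
  have hωE : energy (riesz n α) ω ω ≠ ⊤ := ne_of_lt hωE
  have hσω := energy_ne_top hα hσ hωE
  have hτω := energy_ne_top hα hτ hωE
  rw [← ENNReal.toReal_le_toReal hσω hτω]
  set K := ((energy (riesz n α) σ σ).toReal + (energy (riesz n α) τ τ).toReal) / 2 + 1 with hK
  have hK0 : 0 < K := by positivity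
  refine le_of_forall_pos_le_add fun ε hε => ?_
  set t := ε / K with ht
  have ht0 : 0 < t := by positivity
  obtain ⟨ν, ⟨⟨hνR, hνE⟩, hνA⟩, hd⟩ := hcl t ht0
  have hνR : ν.Regular := hνR
  have hνE : energy (riesz n α) ν ν ≠ ⊤ := ne_of_lt hνE
  have hd2 : sDist (riesz n α) ω ν ^ 2 ≤ t ^ 2 := by
    have : 0 ≤ sDist (riesz n α) ω ν := Real.sqrt_nonneg _
    gcongr
  rw [sq_sDist hα hωE hνE] at hd2
  have h1 := energy_sub_le hα hσ hνE hωE ht0.le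
  have h2 := energy_sub_le hα hτ hωE hνE ht0.le
  rw [energy_comm α ν ω] at h1
  have h3 : (energy (riesz n α) σ ν).toReal ≤ (energy (riesz n α) τ ν).toReal := by
    refine ENNReal.toReal_mono (energy_ne_top hα hτ hνE) ?_
    rw [energy_comm α σ ν, energy_comm α τ ν]
    have hA : ∀ᵐ x ∂ν, x ∈ A := by rw [ae_iff]; exact hνA
    exact lintegral_mono_ae (hA.mono fun x hx => h x hx)
  have h4 : (energy (riesz n α) σ ω).toReal - (energy (riesz n α) τ ω).toReal ≤ t * K := by
    have : 2 * t * ((energy (riesz n α) σ ω).toReal - (energy (riesz n α) τ ω).toReal)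
        ≤ 2 * t * (t * K) := by
      have h5 : 2 * t * ((energy (riesz n α) σ ν).toReal - (energy (riesz n α) τ ν).toReal) ≤ 0 :=
        mul_nonpos_of_nonneg_of_nonpos (by positivity) (by linarith)
      rw [hK]
      nlinarith
    exact le_of_mul_le_mul_left this (by positivity)
  have h5 : t * K = ε := by rw [ht]; field_simp
  linarith

/-- Away from the origin, heat kernels for short times are negligible. -/
lemma exists_heat_le {r : ℝ} (hr : 0 < r) {δ : ℝ} (hδ : 0 < δ) :
    ∃ ε₀ > 0, ∀ s, 0 < s → s ≤ ε₀ → ∀ T ∈ Icc (1 : ℝ) 2, ∀ u : Rn n, r ≤ ‖u‖ →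
      heat n s u ≤ ENNReal.ofReal δ * heat n T u := by
  have hlim : Tendsto (fun s : ℝ => s ^ (-((n : ℝ) / 2)) * Real.exp (-(r ^ 2 / 4) * s⁻¹))
      (𝓝[>] 0) (𝓝 0) := by
    have h1 := (tendsto_rpow_mul_exp_neg_mul_atTop_nhds_zero ((n : ℝ) / 2) (r ^ 2 / 4)
      (by positivity)).comp tendsto_inv_nhdsGT_zero
    refine h1.congr' (eventually_mem_nhdsWithin.mono fun s hs => ?_)
    have hs : 0 < s := hs
    simp only [Function.comp]
    rw [Real.inv_rpow hs.le, Real.rpow_neg hs.le]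
  have hδ' : 0 < δ * 2 ^ (-((n : ℝ) / 2)) := by positivity
  obtain ⟨ε₁, hε₁, hsub⟩ := mem_nhdsGT_iff_exists_Ioc_subset.1 (hlim.eventually_le_const hδ')
  have hε₁ : 0 < ε₁ := hε₁
  refine ⟨min ε₁ (1 / 2), by positivity, fun s hs hsε T hT u hu => ?_⟩
  have hT0 : 0 < T := by linarith [hT.1]
  have hs2 : s ≤ 1 / 2 := hsε.trans (min_le_right _ _)
  have hkey : s ^ (-((n : ℝ) / 2)) * Real.exp (-(r ^ 2 / 4) * s⁻¹) ≤ δ * 2 ^ (-((n : ℝ) / 2)) :=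
    hsub ⟨hs, hsε.trans (min_le_left _ _)⟩
  simp only [heat, hs, hT0, if_true]
  rw [← ENNReal.ofReal_mul hδ.le]
  refine ENNReal.ofReal_le_ofReal ?_
  have hexp : Real.exp (-(1 / (2 * s)) * ‖u‖ ^ 2)
      ≤ Real.exp (-(r ^ 2 / 4) * s⁻¹) * Real.exp (-(1 / (2 * T)) * ‖u‖ ^ 2) := by
    rw [← Real.exp_add]
    refine Real.exp_le_exp.2 ?_
    have h1 : r ^ 2 ≤ ‖u‖ ^ 2 := by gcongr
    have h2 : 1 / (2 * T) ≤ 1 / (4 * s) := by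
      apply one_div_le_one_div_of_le (by positivity); linarith [hT.1]
    have h3 : 1 / (2 * s) * ‖u‖ ^ 2 = s⁻¹ / 4 * ‖u‖ ^ 2 + 1 / (4 * s) * ‖u‖ ^ 2 := by
      field_simp; ring
    have h4 : s⁻¹ / 4 * r ^ 2 ≤ s⁻¹ / 4 * ‖u‖ ^ 2 := by gcongr
    have h5 : 1 / (2 * T) * ‖u‖ ^ 2 ≤ 1 / (4 * s) * ‖u‖ ^ 2 := by gcongr
    linarith
  have hTn : (2 : ℝ) ^ (-((n : ℝ) / 2)) ≤ T ^ (-((n : ℝ) / 2)) :=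
    Real.rpow_le_rpow_of_nonpos hT0 hT.2 (by simp; positivity)
  have hπ : (0 : ℝ) ≤ 2 * Real.pi := by positivity
  rw [Real.mul_rpow hπ hs.le, Real.mul_rpow hπ hT0.le]
  set c := (2 * Real.pi) ^ (-((n : ℝ) / 2)) with hc
  have hc0 : 0 ≤ c := by positivity
  calc c * s ^ (-((n : ℝ) / 2)) * Real.exp (-(1 / (2 * s)) * ‖u‖ ^ 2)
      ≤ c * s ^ (-((n : ℝ) / 2)) * (Real.exp (-(r ^ 2 / 4) * s⁻¹) *
          Real.exp (-(1 / (2 * T)) * ‖u‖ ^ 2)) := by gcongr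
    _ = c * (s ^ (-((n : ℝ) / 2)) * Real.exp (-(r ^ 2 / 4) * s⁻¹)) *
          Real.exp (-(1 / (2 * T)) * ‖u‖ ^ 2) := by ring
    _ ≤ c * (δ * T ^ (-((n : ℝ) / 2))) * Real.exp (-(1 / (2 * T)) * ‖u‖ ^ 2) := by
        exact mul_le_mul_of_nonneg_right
          (mul_le_mul_of_nonneg_left (hkey.trans (by gcongr)) hc0) (Real.exp_pos _).le
    _ = _ := by ring

lemma pot_withDensity_lintegral_smooth (β : ℝ) {m : Measure ℝ} [SFinite m]
    (hm : ∀ᵐ r ∂m, 0 < r) (σ : Measure (Rn n)) [SFinite σ] (x : Rn n) :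
    pot β (volume.withDensity fun y => ∫⁻ r, smooth σ r y ∂m) x =
      ∫⁻ r, smoothF (pot β σ) r x ∂m := by
  have hφ : Measurable fun y => ∫⁻ r, smooth σ r y ∂m :=
    Measurable.lintegral_prod_right' (f := fun p : Rn n × ℝ => smooth σ p.2 p.1) (by fun_prop)
  have h1 : ∀ s, stab β s * smooth (volume.withDensity fun y => ∫⁻ r, smooth σ r y ∂m) s x =
      ∫⁻ r, stab β s * smooth σ (r + s) x ∂m := fun s => by
    rcases le_or_gt s 0 with hs | hs
    · simp [stab_of_nonpos hs]
    rw [lintegral_const_mul _ (by fun_prop)]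
    congr 1
    rw [smooth, lintegral_withDensity_eq_lintegral_mul _ hφ (by fun_prop)]
    change ∫⁻ y, (∫⁻ r, smooth σ r y ∂m) * heat n s (x - y) = ∫⁻ r, smooth σ (r + s) x ∂m
    simp_rw [fun y => (lintegral_mul_const (μ := m) (heat n s (x - y))
      (show Measurable fun r => smooth σ r y by fun_prop)).symm]
    rw [lintegral_lintegral_swap (by fun_prop)]
    refine lintegral_congr_ae (hm.mono fun r hr => ?_)
    simp_rw [mul_comm _ (heat n s _)]
    rw [add_comm]
    exact smoothF_smooth σ hs hr x
  unfold pot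
  simp_rw [h1]
  rw [lintegral_lintegral_swap (by fun_prop)]
  refine lintegral_congr_ae (hm.mono fun r hr => ?_)
  exact (smoothF_pot β σ hr x).symm

lemma shortPot_mul_le {β ε r δ : ℝ} {B : Set (Rn n)} {y : Rn n}
    (hy : ∀ z ∈ B, r ≤ ‖y - z‖)
    (h : ∀ s, 0 < s → s ≤ ε → ∀ T ∈ Icc (1 : ℝ) 2, ∀ u : Rn n, r ≤ ‖u‖ →
      heat n s u ≤ ENNReal.ofReal δ * heat n T u) :
    shortPot β ε (volume.restrict B) y * (∫⁻ T in Icc 1 2, stab β T) ≤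
      (∫⁻ s in Iic ε, stab β s) * (ENNReal.ofReal δ * pot β (volume.restrict B) y) := by
  have h1 : ∀ s, 0 < s → s ≤ ε → smooth (volume.restrict B) s y * (∫⁻ T in Icc 1 2, stab β T) ≤
      ENNReal.ofReal δ * pot β (volume.restrict B) y := fun s hs hsε => by
    have h2 : ∀ T ∈ Icc (1 : ℝ) 2, smooth (volume.restrict B) s y ≤
        ENNReal.ofReal δ * smooth (volume.restrict B) T y := fun T hT => by
      unfold smooth
      rw [← lintegral_const_mul _ (by fun_prop)]
      exact setLIntegral_mono (by fun_prop) fun z hz => h s hs hsε T hT _ (hy z hz)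
    rw [← lintegral_const_mul _ (by fun_prop)]
    unfold pot
    rw [← lintegral_const_mul _ (by fun_prop)]
    refine (setLIntegral_mono (by fun_prop) fun T hT => ?_).trans (setLIntegral_le_lintegral _ _)
    calc _ ≤ ENNReal.ofReal δ * smooth (volume.restrict B) T y * stab β T :=
          mul_le_mul' (h2 T hT) le_rfl
      _ = _ := by ring
  unfold shortPot
  rw [← lintegral_mul_const _ (by fun_prop), ← lintegral_mul_const _ (by fun_prop)]
  refine setLIntegral_mono (by fun_prop) fun s hs => ?_
  rcases le_or_gt s 0 with hs0 | hs0
  · simp [stab_of_nonpos hs0]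
  · rw [mul_assoc]
    exact mul_le_mul' le_rfl (h1 s hs0 hs)

lemma exists_le_lintegral_shortPot (β : ℝ) {B : Set (Rn n)} (hB : IsOpen B) (ω : Measure (Rn n))
    [SFinite ω] {c : ℝ≥0∞} (hc : c < ω B) :
    ∃ ε₁ > 0, ∀ ε ≤ ε₁, (∫⁻ s in Iic ε, stab β s) * c ≤
      ∫⁻ x, shortPot β ε (volume.restrict B) x ∂ω := by
  have hv : LowerSemicontinuous (B.indicator (1 : Rn n → ℝ≥0∞)) :=
    hB.lowerSemicontinuous_indicator zero_le_one
  have h := lintegral_le_liminf_smoothF hv ω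
  rw [lintegral_indicator_one hB.measurableSet] at h
  obtain ⟨ε₁, hε₁, hsub⟩ := mem_nhdsGT_iff_exists_Ioc_subset.1
    (eventually_lt_of_lt_liminf (hc.trans_le h))
  refine ⟨ε₁, hε₁, fun ε hε => ?_⟩
  rw [lintegral_shortPot, ← lintegral_mul_const _ (by fun_prop)]
  have hm : Measurable fun s => ∫⁻ x, smooth (volume.restrict B) s x ∂ω :=
    Measurable.lintegral_prod_right'
      (f := fun p : ℝ × Rn n => smooth (volume.restrict B) p.1 p.2) (by fun_prop)
  refine setLIntegral_mono (by fun_prop) fun s hs => ?_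
  rcases le_or_gt s 0 with hs0 | hs0
  · simp [stab_of_nonpos hs0]
  · simp_rw [smooth_restrict B hB.measurableSet]
    exact mul_le_mul' le_rfl (le_of_lt (hsub ⟨hs0, le_trans hs hε⟩))

/-- A measure in the strong closure `E'(A)`, `A` closed, which does not charge `A` vanishes. -/
lemma eq_zero_of_memEClos {α : ℝ} (hα0 : 0 < α) (hα2 : α ≤ 2) (hαn : α < n) {A : Set (Rn n)}
    (hA : IsClosed A) {ω : Measure (Rn n)} (hω : memEClos (riesz n α) A ω) (hωA : ω A = 0) :
    ω = 0 := by
  have hωR : ω.Regular := hω.1.1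
  have hωE : energy (riesz n α) ω ω ≠ ⊤ := ne_of_lt hω.1.2
  by_contra hne
  have hAc : ω Aᶜ ≠ 0 := fun h => hne <| Measure.measure_univ_eq_zero.1 <| by
    rw [← union_compl_self A]; exact measure_union_null hωA h
  obtain ⟨x₀, hx₀, hx₀pos⟩ := exists_mem_forall_mem_nhdsWithin_pos_measure hAc
  obtain ⟨ρ, hρ, hball⟩ := Metric.isOpen_iff.1 hA.isOpen_compl x₀ hx₀
  set r := ρ / 2 with hr
  have hr0 : 0 < r := by positivity
  set B := Metric.ball x₀ r with hB
  set σ := volume.restrict B with hσ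
  have hβ : 0 < α / 2 := by positivity
  have hBpos : 0 < ω B := hx₀pos B (mem_nhdsWithin_of_mem_nhds (Metric.ball_mem_nhds x₀ hr0))
  have hBtop : ω B ≠ ⊤ := measure_ball_lt_top.ne
  have hfar : ∀ y ∈ A, ∀ z ∈ B, r ≤ ‖y - z‖ := fun y hy z hz => by
    have h1 : ρ ≤ dist y x₀ := not_lt.1 fun h => hball h hy
    have h2 : dist z x₀ < r := hz
    have h3 := dist_triangle y z x₀
    rw [dist_eq_norm y z] at h3
    linarith
  have hC := rieszConst_pos hαn
  have hC0 : ENNReal.ofReal (rieszConst n α) ≠ 0 := by simpa using hC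
  have hE : ∀ {μ : Measure (Rn n)} [SFinite μ], ∫⁻ x, pot (α / 2) μ x ∂μ ≠ ⊤ →
      energy (riesz n α) μ μ ≠ ⊤ := fun {μ} _ h h' => h <| by
    rw [lintegral_pot_eq_energy hαn, h', ENNReal.mul_top hC0]
  have hσpot : ∫⁻ x, pot (α / 2) σ x ∂σ ≠ ⊤ := by
    obtain ⟨C, hCtop, hCle⟩ := exists_pot_restrict_le hβ (by linarith)
      Metric.isOpen_ball.measurableSet (measure_ball_lt_top (μ := volume) (x := x₀) (r := r))
    refine ((lintegral_mono hCle).trans_lt ?_).ne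
    rw [lintegral_const, hσ, Measure.restrict_apply_univ]
    exact ENNReal.mul_lt_top hCtop.lt_top measure_ball_lt_top
  have hσE := hE hσpot
  have hM : ∫⁻ x, pot (α / 2) σ x ∂ω ≠ ⊤ := by
    rw [lintegral_pot_eq_energy hαn]
    exact ENNReal.mul_ne_top ENNReal.ofReal_ne_top (energy_ne_top hαn hωE hσE)
  set M := ∫⁻ x, pot (α / 2) σ x ∂ω with hMdef
  set k := ∫⁻ T in Icc (1 : ℝ) 2, stab (α / 2) T with hk
  have hk0 : k ≠ 0 := by
    refine ne_of_gt ((setLIntegral_pos_iff (by fun_prop)).2 ?_)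
    refine lt_of_lt_of_le ?_ (measure_mono (show Icc (1 : ℝ) 2 ⊆ _ from fun s hs => ⟨?_, hs⟩))
    · rw [Real.volume_Icc]; norm_num
    · have hs0 : 0 < s := by linarith [hs.1]
      rw [Function.mem_support, stab_of_pos hs0]
      simpa using Real.rpow_pos_of_pos hs0 _
  have hktop : k ≠ ⊤ :=
    ((lintegral_mono_set fun s hs => hs.2).trans_lt
      (lintegral_stab_Iic_lt_top hβ two_pos)).ne
  have hc0 : ω B / 2 ≠ 0 := by simpa using hBpos.ne'
  obtain ⟨δ, hδ, hδlt⟩ := ENNReal.exists_nnreal_pos_mul_lt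
    (ENNReal.mul_ne_top hM (ENNReal.inv_ne_top.2 hk0)) hc0
  obtain ⟨ε₀, hε₀, hheat⟩ := exists_heat_le (n := n) hr0 (δ := δ) (by exact_mod_cast hδ)
  obtain ⟨ε₁, hε₁, hlow⟩ := exists_le_lintegral_shortPot (α / 2)
    (Metric.isOpen_ball (x := x₀) (ε := r)) ω (ENNReal.half_lt_self hBpos.ne' hBtop)
  have hε : 0 < min ε₀ ε₁ := lt_min hε₀ hε₁
  set ε := min ε₀ ε₁ with hεdef
  obtain ⟨m, hmP, hm0, hm⟩ := exists_firstPassage hβ (by linarith) hε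
  set σ' := volume.withDensity fun y => ∫⁻ r, smooth σ r y ∂m with hσ'
  have hdec : ∀ x, pot (α / 2) σ x = pot (α / 2) σ' x + shortPot (α / 2) ε σ x := fun x => by
    rw [pot_withDensity_lintegral_smooth _ hm0]
    exact pot_eq_lintegral_smoothF_add hm0 hm σ x
  have hle : ∀ x, pot (α / 2) σ' x ≤ pot (α / 2) σ x := fun x => by
    rw [hdec x]; exact le_self_add
  have hσ'E : energy (riesz n α) σ' σ' ≠ ⊤ := hE <| ne_top_of_le_ne_top hσpot <|
    calc _ ≤ ∫⁻ x, pot (α / 2) σ x ∂σ' := lintegral_mono hle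
      _ = ∫⁻ x, pot (α / 2) σ' x ∂σ := lintegral_pot_comm _ _ _
      _ ≤ _ := lintegral_mono hle
  set S := ∫⁻ s in Iic ε, stab (α / 2) s with hS
  have hS0 : S ≠ 0 := (lintegral_stab_Iic_pos _ hε).ne'
  have hStop : S ≠ ⊤ := (lintegral_stab_Iic_lt_top hβ hε).ne
  set c := S * δ * k⁻¹ with hc
  have hctop : c ≠ ⊤ := ENNReal.mul_ne_top (ENNReal.mul_ne_top hStop ENNReal.coe_ne_top)
    (ENNReal.inv_ne_top.2 hk0)
  have hshort : ∀ y ∈ A, shortPot (α / 2) ε σ y ≤ c * pot (α / 2) σ y := fun y hy => by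
    have h := shortPot_mul_le (β := α / 2) (ε := ε) (hfar y hy)
      fun s hs hsε => hheat s hs (hsε.trans (min_le_left _ _))
    rw [ENNReal.ofReal_coe_nnreal, ← hσ, ← hk, ← hS] at h
    calc shortPot (α / 2) ε σ y = shortPot (α / 2) ε σ y * k * k⁻¹ := by
          rw [mul_assoc, ENNReal.mul_inv_cancel hk0 hktop, mul_one]
      _ ≤ S * (δ * pot (α / 2) σ y) * k⁻¹ := mul_le_mul' h le_rfl
      _ = c * pot (α / 2) σ y := by rw [hc]; ring
  have hτE : energy (riesz n α) (σ' + c • σ) (σ' + c • σ) ≠ ⊤ := by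
    have h1 : ∀ (ν : Measure (Rn n)) [SFinite ν], energy (riesz n α) σ' ν ≠ ⊤ →
        energy (riesz n α) σ ν ≠ ⊤ → energy (riesz n α) (σ' + c • σ) ν ≠ ⊤ := fun ν _ h h' => by
      rw [energy_add_left, energy_smul_left]
      exact ENNReal.add_ne_top.2 ⟨h, ENNReal.mul_ne_top hctop h'⟩
    refine h1 _ ?_ ?_
    · rw [energy_comm]
      exact h1 _ hσ'E (energy_ne_top hαn hσE hσ'E)
    · rw [energy_comm]
      exact h1 _ (energy_ne_top hαn hσ'E hσE) hσE
  have hen := energy_le_of_memEClos hαn hω hσE hτE fun y hy => by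
    rw [potential_add, potential_smul]
    refine (ENNReal.mul_le_mul_iff_right hC0 ENNReal.ofReal_ne_top).1 ?_
    rw [mul_add, mul_left_comm, ← pot_eq_potential hαn, ← pot_eq_potential hαn, hdec y]
    exact add_le_add le_rfl ((hshort y hy).trans (by rw [hdec y]))
  have hint : M ≤ (∫⁻ x, pot (α / 2) σ' x ∂ω) + c * M := by
    rw [hMdef, lintegral_pot_eq_energy hαn, lintegral_pot_eq_energy hαn, mul_left_comm, ← mul_add]
    refine mul_le_mul' le_rfl ?_
    rw [energy_add_left, energy_smul_left] at hen
    rwa [energy_comm α ω σ, energy_comm α ω σ']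
  have hsum : M = (∫⁻ x, pot (α / 2) σ' x ∂ω) + ∫⁻ x, shortPot (α / 2) ε σ x ∂ω := by
    rw [hMdef, ← lintegral_add_left (by fun_prop)]
    exact lintegral_congr hdec
  have hσ'M : ∫⁻ x, pot (α / 2) σ' x ∂ω ≠ ⊤ := ne_top_of_le_ne_top hM (lintegral_mono hle)
  nth_rewrite 1 [hsum] at hint
  have hfin := (hlow ε (min_le_right _ _)).trans ((ENNReal.add_le_add_iff_left hσ'M).1 hint)
  rw [hc, show S * δ * k⁻¹ * M = S * (δ * (M * k⁻¹)) by ring, ← hS,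
    ENNReal.mul_le_mul_iff_right hS0 hStop] at hfin
  exact absurd hδlt (not_lt.2 hfin)

lemma innerCap_eq_zero_mono {X : Type*} [TopologicalSpace X] [MeasurableSpace X]
    {κ : X → X → ℝ≥0∞} {P Q : Set X} (hQ : innerCap κ Q = 0) (h : P ⊆ Q) : innerCap κ P = 0 :=
  nonpos_iff_eq_zero.1 ((innerCap_mono κ h).trans hQ.le)

lemma memGamma_combination {α : ℝ} (hαn : α < n) {A : Set (Rn n)} {ω μ : Measure (Rn n)}
    (hω : memE (riesz n α) ω) (hμ : memGamma (riesz n α) A ω μ) {a b : ℝ≥0∞} (hab : a + b = 1) :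
    memGamma (riesz n α) A ω (a • ω + b • μ) := by
  have hωR : ω.Regular := hω.1
  have hμR : μ.Regular := hμ.1.1
  have ha : a ≠ ⊤ := ne_top_of_le_ne_top one_ne_top (hab ▸ le_self_add)
  have hb : b ≠ ⊤ := ne_top_of_le_ne_top one_ne_top (hab ▸ le_add_self)
  have hωE : energy (riesz n α) ω ω ≠ ⊤ := ne_of_lt hω.2
  have hμE : energy (riesz n α) μ μ ≠ ⊤ := ne_of_lt hμ.1.2
  have hfin : IsFiniteMeasureOnCompacts (a • ω + b • μ) := ⟨fun K hK => by
    simpa using ENNReal.add_lt_top.2 ⟨ENNReal.mul_lt_top ha.lt_top hK.measure_lt_top,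
      ENNReal.mul_lt_top hb.lt_top hK.measure_lt_top⟩⟩
  refine ⟨⟨show (a • ω + b • μ).Regular from inferInstance, lt_top_iff_ne_top.2 ?_⟩, ?_⟩
  · have h : ∀ ν : Measure (Rn n), energy (riesz n α) ω ν ≠ ⊤ → energy (riesz n α) μ ν ≠ ⊤ →
        energy (riesz n α) (a • ω + b • μ) ν ≠ ⊤ := fun ν h₁ h₂ => by
      rw [energy_add_left, energy_smul_left, energy_smul_left]
      exact ENNReal.add_ne_top.2 ⟨ENNReal.mul_ne_top ha h₁, ENNReal.mul_ne_top hb h₂⟩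
    refine h _ ?_ ?_ <;> rw [energy_comm]
    · exact h _ hωE (energy_ne_top hαn hμE hωE)
    · exact h _ (energy_ne_top hαn hωE hμE) hμE
  · refine innerCap_eq_zero_mono hμ.2 fun x hx => ⟨hx.1, fun h => hx.2 ?_⟩
    rw [potential_add, potential_smul, potential_smul]
    calc potential (riesz n α) ω x
        = a * potential (riesz n α) ω x + b * potential (riesz n α) ω x := by
          rw [← add_mul, hab, one_mul]
      _ ≤ _ := add_le_add le_rfl (mul_le_mul' le_rfl h)

/-- A segment joining two distinct Radon measures contains infinitely many measures. -/
lemma injective_combination {μ ν : Measure (Rn n)} [IsLocallyFiniteMeasure μ]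
    [IsLocallyFiniteMeasure ν] (h : ν ≠ μ) :
    Function.Injective fun k : ℕ => (k + 1 : ℝ≥0∞)⁻¹ • μ + (1 - (k + 1 : ℝ≥0∞)⁻¹) • ν := by
  obtain ⟨U, hU, hUb, hne⟩ : ∃ U, IsOpen U ∧ Bornology.IsBounded U ∧ ν U ≠ μ U := by
    by_contra! hcon
    exact h (Measure.OuterRegular.ext_isOpen_isBounded fun U hU hb => hcon U hU hb)
  have hμ : μ U ≠ ⊤ := hUb.measure_lt_top.ne
  have hν : ν U ≠ ⊤ := hUb.measure_lt_top.ne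
  intro k l hkl
  have hval : ∀ k : ℕ, (((k + 1 : ℝ≥0∞)⁻¹ • μ + (1 - (k + 1 : ℝ≥0∞)⁻¹) • ν) U).toReal =
      ((k : ℝ) + 1)⁻¹ * (μ U).toReal + (1 - ((k : ℝ) + 1)⁻¹) * (ν U).toReal := fun k => by
    have h1 : (k + 1 : ℝ≥0∞)⁻¹ ≤ 1 := by simp
    have h2 : (k + 1 : ℝ≥0∞)⁻¹ ≠ ⊤ := ne_top_of_le_ne_top one_ne_top h1
    simp only [Measure.add_apply, Measure.smul_apply, smul_eq_mul]
    rw [ENNReal.toReal_add (ENNReal.mul_ne_top h2 hμ)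
      (ENNReal.mul_ne_top (ENNReal.sub_ne_top one_ne_top) hν), ENNReal.toReal_mul,
      ENNReal.toReal_mul, ENNReal.toReal_sub_of_le h1 one_ne_top, ENNReal.toReal_inv,
      ENNReal.toReal_add (ENNReal.natCast_ne_top k) one_ne_top, ENNReal.toReal_natCast,
      ENNReal.toReal_one]
  have heq := congrArg (fun ρ : Measure (Rn n) => (ρ U).toReal) hkl
  simp only [hval] at heq
  have hne' : (μ U).toReal - (ν U).toReal ≠ 0 :=
    sub_ne_zero.2 fun h' => hne ((ENNReal.toReal_eq_toReal_iff' hμ hν).1 h').symm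
  have hinv : ((k : ℝ) + 1)⁻¹ = ((l : ℝ) + 1)⁻¹ := mul_right_cancel₀ hne' (by linarith)
  exact_mod_cast add_right_cancel (inv_injective hinv)

end

/-- For the α-Riesz kernel and a proper closed set `A ⊆ ℝⁿ` not inner
α-thin at infinity: `ω^A ≠ ω` while `ω^A(ℝⁿ) = ω(ℝⁿ)`; both `ω` and `ω^A` lie in `Γ_{A,ω}`,
every convex combination `a·ω + b·ω^A` has minimum total mass in `Γ_{A,ω}`, and hence there
are infinitely many measures of minimum total mass in `Γ_{A,ω}`. -/
theorem riesz_min_mass_not_unique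
    (n : ℕ) (hn : 2 ≤ n) (α : ℝ) (hα0 : 0 < α) (hα2 : α ≤ 2) (hαn : α < (n : ℝ))
    (A : Set (Rn n)) (hAcl : IsClosed A) (hAne : A ≠ Set.univ)
    (hthin : ¬ InnerThinAtInfinity n α A)
    (ω : Measure (Rn n)) (hω : memEOn (riesz n α) Aᶜ ω) (hω0 : ω ≠ 0)
    (ωA : Measure (Rn n)) (hωA : IsInnerBalayage (riesz n α) A ω ωA) :
    ωA ≠ ω ∧ ωA Set.univ = ω Set.univ ∧
    memGamma (riesz n α) A ω ω ∧ memGamma (riesz n α) A ω ωA ∧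
    (∀ a b : ℝ≥0∞, a + b = 1 →
      memGamma (riesz n α) A ω (a • ω + b • ωA) ∧
      ∀ ν : Measure (Rn n), memGamma (riesz n α) A ω ν →
        (a • ω + b • ωA) Set.univ ≤ ν Set.univ) ∧
    {ν : Measure (Rn n) | memGamma (riesz n α) A ω ν ∧
      ∀ ν' : Measure (Rn n), memGamma (riesz n α) A ω ν' →
        ν Set.univ ≤ ν' Set.univ}.Infinite := by
  obtain ⟨hωE, hωAc⟩ := hω
  rw [compl_compl] at hωAc
  obtain ⟨hclos, hcap⟩ := hωA
  have hωR : ω.Regular := hωE.1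
  have hωAR : ωA.Regular := hclos.1.1
  have hne : ωA ≠ ω := fun h => hω0 (eq_zero_of_memEClos hα0 hα2 hαn hAcl (h ▸ hclos) hωAc)
  have hmin : ∀ ν, memGamma (riesz n α) A ω ν → ω univ ≤ ν univ := fun ν hν => by
    have hνR : ν.Regular := hν.1.1
    exact mass_le_of_potential_le hα0 hα2 hαn hAcl.measurableSet hthin hν.2
  have hΓ : memGamma (riesz n α) A ω ω := ⟨hωE, by simp [innerCap_empty]⟩
  have hΓA : memGamma (riesz n α) A ω ωA := ⟨hclos.1,
    innerCap_eq_zero_mono hcap fun x hx => ⟨hx.1, fun h => hx.2 h.ge⟩⟩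
  have hmass : ωA univ = ω univ := by
    refine le_antisymm (mass_le_of_potential_le hα0 hα2 hαn hAcl.measurableSet hthin ?_)
      (hmin ωA hΓA)
    exact innerCap_eq_zero_mono hcap fun x hx => ⟨hx.1, fun h => hx.2 h.le⟩
  have hcomb : ∀ a b : ℝ≥0∞, a + b = 1 → memGamma (riesz n α) A ω (a • ω + b • ωA) ∧
      ∀ ν : Measure (Rn n), memGamma (riesz n α) A ω ν →
        (a • ω + b • ωA) univ ≤ ν univ := fun a b hab => by
    refine ⟨memGamma_combination hαn hωE hΓA hab, fun ν hν => ?_⟩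
    rw [Measure.add_apply, Measure.smul_apply, Measure.smul_apply, smul_eq_mul, smul_eq_mul,
      hmass, ← add_mul, hab, one_mul]
    exact hmin ν hν
  refine ⟨hne, hmass, hΓ, hΓA, hcomb, infinite_of_injective_forall_mem (injective_combination hne)
    fun k => hcomb _ _ (add_tsub_cancel_of_le (by simp))⟩

end Balayage
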